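/- Let P ∈ 𝓜³ be a maximal lattice-free integral polytope that is either a simplex or a pyramid with quadrilateral base, with base F ⊆ ℝ² × {0} and apex a = (a₁, a₂, a₃), where h := a₃ ≥ 4. Identify F with an integral polygon in ℝ². Then the lattice width of F satisfies w(F) = 2, and 2·i(F) + b(F) ≤ ⌊(6h−4)/(h−2)⌋ ≤ 10, where i(F) and b(F) denote the numbers of integer points in the relative interior and on the relative boundary of F, respectively. In particular, if P is a simplex then (i(F), b(F)) ∈ {(1,j) : j = 3,…,8} ∪ {(2,j) : j = 3,…,6}, and if P is a pyramid with quadrilateral base then (i(F), b(F)) ∈ {(1,j) : j = 4,…,8} ∪ {(2,j) : j = 4,…,6}. -/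

import Mathlib

open Set

/-- The set of integer points `ℤ^d` inside `ℝ^d`. -/
def intPts (d : ℕ) : Set (Fin d → ℝ) := {x | ∀ i, ∃ z : ℤ, x i = (z : ℝ)}

/-- The lattice `Λ = s·ℤ^d` inside `ℝ^d`. -/
def sLat (d s : ℕ) : Set (Fin d → ℝ) := {x | ∀ i, ∃ z : ℤ, x i = (s : ℝ) * (z : ℝ)}

/-- A polyhedron: a finite intersection of closed halfspaces. -/
def IsPolyhedron {d : ℕ} (P : Set (Fin d → ℝ)) : Prop :=
  ∃ (n : ℕ) (A : Fin n → Fin d → ℝ) (b : Fin n → ℝ),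
    P = {x | ∀ i, (∑ j, A i j * x j) ≤ b i}

/-- An integral set: it equals the convex hull of its integer points. -/
def IsIntegralPoly {d : ℕ} (P : Set (Fin d → ℝ)) : Prop :=
  P = convexHull ℝ (P ∩ intPts d)

/-- The affine map `x ↦ U·x + t` with integer matrix `U` and translation `t : ℝ^d`. -/
noncomputable def affMap {d : ℕ} (U : Matrix (Fin d) (Fin d) ℤ) (t : Fin d → ℝ)
    (x : Fin d → ℝ) : Fin d → ℝ := fun i => (∑ j, (U i j : ℝ) * x j) + t i

/-- Membership in `𝓜³`: a maximal lattice-free integral polytope in `ℝ³`, i.e. a bounded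
integral polyhedron with nonempty interior, whose interior contains no integer point, and
which is not properly contained in any convex set whose interior contains no integer point. -/
def MemM3 (P : Set (Fin 3 → ℝ)) : Prop :=
  IsPolyhedron P ∧ Bornology.IsBounded P ∧ IsIntegralPoly P ∧ (interior P).Nonempty ∧
    interior P ∩ intPts 3 = ∅ ∧
    ∀ K : Set (Fin 3 → ℝ), Convex ℝ K → interior K ∩ intPts 3 = ∅ → P ⊆ K → P = K

/-- The width of `K ⊆ ℝ²` in direction `u ∈ ℤ²`. -/
noncomputable def widthAlong (K : Set (Fin 2 → ℝ)) (u : Fin 2 → ℤ) : ℝ :=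
  sSup ((fun x => ∑ i, (u i : ℝ) * x i) '' K) - sInf ((fun x => ∑ i, (u i : ℝ) * x i) '' K)

/-- The projection of `ℝ³` onto the first two coordinates. -/
def proj2 (x : Fin 3 → ℝ) : Fin 2 → ℝ := ![x 0, x 1]



namespace LatticePolygon

/-- The real point underlying an integer point of the plane. -/
def toReal (v : ℤ × ℤ) : ℝ × ℝ := ((v.1 : ℝ), (v.2 : ℝ))

/-- The convex hull of a set of integer points. -/
def hull (V : Set (ℤ × ℤ)) : Set (ℝ × ℝ) := convexHull ℝ (toReal '' V)

/-- `x` is not cut off by any halfplane containing `V`. -/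
def Covered (V : Set (ℤ × ℤ)) (x : ℝ × ℝ) : Prop :=
  ∀ p q : ℝ, ∃ v ∈ V, p * x.1 + q * x.2 ≤ p * v.1 + q * v.2

/-- `x` is strictly inside every halfplane containing `V`. -/
def Inside (V : Set (ℤ × ℤ)) (x : ℝ × ℝ) : Prop :=
  ∀ p q : ℝ, (p ≠ 0 ∨ q ≠ 0) → ∃ v ∈ V, p * x.1 + q * x.2 < p * v.1 + q * v.2

/-- The sections at heights `1` and `2` of the pyramid with base `hull V` and apex `(α, h)`
have no interior lattice points; the sections are rescaled back to the base plane. -/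
def Free (V : Set (ℤ × ℤ)) (h : ℤ) (α : ℤ × ℤ) : Prop :=
  ∀ k : ℤ, (k = 1 ∨ k = 2) → ∀ m n : ℤ,
    ¬ Inside V (((h : ℝ) * m - k * α.1) / (h - k), ((h : ℝ) * n - k * α.2) / (h - k))

/-- Every nonzero integer direction has width at least `n` on `V`. -/
def WidthGe (V : Set (ℤ × ℤ)) (n : ℤ) : Prop :=
  ∀ p q : ℤ, (p ≠ 0 ∨ q ≠ 0) → ∃ v ∈ V, ∃ w ∈ V, n ≤ p * (v.1 - w.1) + q * (v.2 - w.2)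

theorem toReal_mem_hull {V : Set (ℤ × ℤ)} {v : ℤ × ℤ} (hv : v ∈ V) : toReal v ∈ hull V :=
  subset_convexHull ℝ _ (mem_image_of_mem _ hv)

theorem convex_hull (V : Set (ℤ × ℤ)) : Convex ℝ (hull V) := convex_convexHull ℝ _

theorem hull_le {V : Set (ℤ × ℤ)} {p q r : ℝ} (hV : ∀ v ∈ V, p * (v.1 : ℝ) + q * v.2 ≤ r)
    {x : ℝ × ℝ} (hx : x ∈ hull V) : p * x.1 + q * x.2 ≤ r := by
  have hc : Convex ℝ {y : ℝ × ℝ | p * y.1 + q * y.2 ≤ r} := by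
    intro y hy z hz a b ha hb hab
    simp only [mem_ofPred_eq, Prod.fst_add, Prod.snd_add, Prod.smul_fst, Prod.smul_snd,
      smul_eq_mul] at *
    have hr : r = a * r + b * r := by rw [← add_mul, hab, one_mul]
    nlinarith [mul_le_mul_of_nonneg_left hy ha, mul_le_mul_of_nonneg_left hz hb]
  exact convexHull_min (by rintro _ ⟨v, hv, rfl⟩; exact hV v hv) hc hx

theorem covered_of_mem_hull {V : Set (ℤ × ℤ)} {x : ℝ × ℝ} (hx : x ∈ hull V) : Covered V x := by
  intro p q
  by_contra! hcon
  have hc : Convex ℝ {y : ℝ × ℝ | p * y.1 + q * y.2 < p * x.1 + q * x.2} := by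
    intro y hy z hz a b ha hb hab
    simp only [mem_ofPred_eq, Prod.fst_add, Prod.snd_add, Prod.smul_fst, Prod.smul_snd,
      smul_eq_mul] at *
    rcases ha.eq_or_lt with rfl | ha
    · have hb1 : b = 1 := by linarith
      subst hb1
      linarith
    · have hr : p * x.1 + q * x.2 = a * (p * x.1 + q * x.2) + b * (p * x.1 + q * x.2) := by
        rw [← add_mul, hab, one_mul]
      nlinarith [mul_lt_mul_of_pos_left hy ha, mul_le_mul_of_nonneg_left hz.le hb]
  have := convexHull_min (by rintro _ ⟨v, hv, rfl⟩; exact hcon v hv) hc hx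
  exact lt_irrefl (p * x.1 + q * x.2) this

theorem combo_mem_hull {V : Set (ℤ × ℤ)} {A B : ℝ × ℝ} (hA : A ∈ hull V) (hB : B ∈ hull V)
    {t : ℝ} (h0 : 0 ≤ t) (h1 : t ≤ 1) :
    ((1 - t) * A.1 + t * B.1, (1 - t) * A.2 + t * B.2) ∈ hull V :=
  convex_hull V hA hB (sub_nonneg.2 h1) h0 (by ring)

/-- A point in the relative interior of a horizontal chord is inside if the hull extends
both above and below the chord. -/
theorem inside_of_chord {V : Set (ℤ × ℤ)} {x₁ x₂ x y : ℝ} {C D : ℝ × ℝ}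
    (h₁ : (x₁, y) ∈ hull V) (h₂ : (x₂, y) ∈ hull V) (hC : C ∈ hull V) (hD : D ∈ hull V)
    (hx₁ : x₁ < x) (hx₂ : x < x₂) (hyC : C.2 < y) (hyD : y < D.2) : Inside V (x, y) := by
  intro p q hpq
  rcases lt_trichotomy p 0 with hp | rfl | hp
  · obtain ⟨v, hv, hle⟩ := covered_of_mem_hull h₁ p q
    exact ⟨v, hv, by simp only at *; nlinarith⟩
  · rcases lt_or_gt_of_ne (hpq.resolve_left (by simp)) with hq | hq
    · obtain ⟨v, hv, hle⟩ := covered_of_mem_hull hC 0 q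
      exact ⟨v, hv, by simp only at *; nlinarith⟩
    · obtain ⟨v, hv, hle⟩ := covered_of_mem_hull hD 0 q
      exact ⟨v, hv, by simp only at *; nlinarith⟩
  · obtain ⟨v, hv, hle⟩ := covered_of_mem_hull h₂ p q
    exact ⟨v, hv, by simp only at *; nlinarith⟩

/-- Interior horizontal chords of `V` at a lattice height of the section `k` are short. -/
theorem Free.chord_le {V : Set (ℤ × ℤ)} {h : ℤ} {α : ℤ × ℤ} (hfree : Free V h α)
    (hh : 4 ≤ h) {x₁ x₂ y : ℝ} {C D : ℝ × ℝ} (n : ℤ) (hn : (h - 1) * y = h * n - α.2)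
    (h₁ : (x₁, y) ∈ hull V) (h₂ : (x₂, y) ∈ hull V) (hC : C ∈ hull V) (hD : D ∈ hull V)
    (hyC : C.2 < y) (hyD : y < D.2) : (x₂ - x₁) * (h - 1) ≤ h := by
  by_contra! hlt
  have hh' : (4 : ℝ) ≤ h := by exact_mod_cast hh
  have hpos : (0 : ℝ) < h - 1 := by linarith
  have hh0 : (0 : ℝ) < h := by linarith
  set m : ℤ := ⌊(((h : ℝ) - 1) * x₁ + α.1) / h⌋ + 1 with hm
  have hm1 : (((h : ℝ) - 1) * x₁ + α.1) / h < m := by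
    rw [hm]; push_cast; exact Int.lt_floor_add_one _
  have hm2 : (m : ℝ) ≤ (((h : ℝ) - 1) * x₁ + α.1) / h + 1 := by
    rw [hm]; push_cast; linarith [Int.floor_le ((((h : ℝ) - 1) * x₁ + α.1) / h)]
  rw [div_lt_iff₀ hh0] at hm1
  rw [div_add_one hh0.ne', le_div_iff₀ hh0] at hm2
  refine hfree 1 (Or.inl rfl) m n ?_
  have hy : y = ((h : ℝ) * n - (1 : ℤ) * α.2) / (h - (1 : ℤ)) := by
    push_cast
    rw [eq_div_iff hpos.ne']; linarith
  rw [← hy]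
  refine inside_of_chord h₁ h₂ hC hD ?_ ?_ hyC hyD
  · push_cast; rw [lt_div_iff₀ hpos]; linarith
  · push_cast; rw [div_lt_iff₀ hpos]; linarith

/-- A long chord at an integer height with the hull extending at least `1` below and at least
`2` above it is impossible. -/
theorem Free.chord_le_two {V : Set (ℤ × ℤ)} {h : ℤ} {α : ℤ × ℤ} (hfree : Free V h α)
    (hh : 4 ≤ h) {x₁ x₂ : ℝ} {y : ℤ} {C D : ℝ × ℝ}
    (h₁ : (x₁, (y : ℝ)) ∈ hull V) (h₂ : (x₂, (y : ℝ)) ∈ hull V)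
    (hC : C ∈ hull V) (hD : D ∈ hull V) (hyC : C.2 ≤ y - 1) (hyD : y + 2 ≤ D.2) :
    x₂ - x₁ ≤ 2 := by
  by_contra! hlt
  have hh' : (4 : ℝ) ≤ h := by exact_mod_cast hh
  have hpos : (0 : ℝ) < h - 1 := by linarith
  obtain ⟨j, n, hj1, hj2, hjn⟩ : ∃ j n : ℤ, -1 ≤ j ∧ j ≤ h - 2 ∧ (h - 1) * y + j = h * n - α.2 := by
    refine ⟨(-α.2 - (h - 1) * y + 1) % h - 1, -((-α.2 - (h - 1) * y + 1) / h), ?_, ?_, ?_⟩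
    · have := Int.emod_nonneg (-α.2 - (h - 1) * y + 1) (by omega : h ≠ 0); omega
    · have := Int.emod_lt_of_pos (-α.2 - (h - 1) * y + 1) (by omega : 0 < h); omega
    · have := Int.emod_add_mul_ediv (-α.2 - (h - 1) * y + 1) h; linarith
  have hjn' : ((h : ℝ) - 1) * y + j = h * n - α.2 := by exact_mod_cast hjn
  have hj2' : (j : ℝ) ≤ h - 2 := by exact_mod_cast hj2
  rcases (by omega : j = -1 ∨ 0 ≤ j) with rfl | hj0
  · push_cast at hjn'
    set t : ℝ := 1 / ((h - 1) * (y - C.2)) with ht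
    have hden : (0 : ℝ) < (h - 1) * (y - C.2) := mul_pos hpos (by linarith)
    have htd : t * (y - C.2) * (h - 1) = 1 := by rw [ht]; field_simp; rw [div_self (by linarith)]
    have ht0 : 0 < t := by rw [ht]; positivity
    have ht1 : t * (h - 1) ≤ 1 := by nlinarith [mul_pos ht0 hpos]
    have ht2 : t ≤ 1 := by nlinarith
    have e1 := combo_mem_hull h₁ hC ht0.le ht2
    have e2 := combo_mem_hull h₂ hC ht0.le ht2
    have := hfree.chord_le hh n (by linarith) e1 e2 hC hD (by simp only; nlinarith)
      (by simp only; nlinarith)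
    nlinarith
  · have hj0' : (0 : ℝ) ≤ j := by exact_mod_cast hj0
    have hd : 0 < D.2 - y := by linarith
    set t : ℝ := j / ((h - 1) * (D.2 - y)) with ht
    have htd : t * (D.2 - y) * (h - 1) = j := by rw [ht]; field_simp
    have ht0 : 0 ≤ t := by rw [ht]; positivity
    have ht1 : t * (h - 1) * 2 ≤ j := by nlinarith [mul_nonneg ht0 hpos.le]
    have ht2 : t < 1 := by nlinarith
    have e1 := combo_mem_hull h₁ hD ht0 ht2.le
    have e2 := combo_mem_hull h₂ hD ht0 ht2.le
    have := hfree.chord_le hh n (by linarith) e1 e2 hC hD (by simp only; nlinarith)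
      (by simp only; nlinarith)
    nlinarith

/-- A horizontal edge of length at least `3` with the hull extending at least `3` above it
is impossible. -/
theorem Free.edge_lt_three {V : Set (ℤ × ℤ)} {h : ℤ} {α : ℤ × ℤ} (hfree : Free V h α)
    (hh : 4 ≤ h) {x₁ x₂ : ℝ} {y : ℤ} {D : ℝ × ℝ}
    (h₁ : (x₁, (y : ℝ)) ∈ hull V) (h₂ : (x₂, (y : ℝ)) ∈ hull V)
    (hD : D ∈ hull V) (hyD : y + 3 ≤ D.2) : x₂ - x₁ < 3 := by
  by_contra! hlt
  have hh' : (4 : ℝ) ≤ h := by exact_mod_cast hh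
  have hpos : (0 : ℝ) < h - 1 := by linarith
  obtain ⟨j, n, hj1, hj2, hjn⟩ : ∃ j n : ℤ, 1 ≤ j ∧ j ≤ h ∧ (h - 1) * y + j = h * n - α.2 := by
    refine ⟨(-α.2 - (h - 1) * y - 1) % h + 1, -((-α.2 - (h - 1) * y - 1) / h), ?_, ?_, ?_⟩
    · have := Int.emod_nonneg (-α.2 - (h - 1) * y - 1) (by omega : h ≠ 0); omega
    · have := Int.emod_lt_of_pos (-α.2 - (h - 1) * y - 1) (by omega : 0 < h); omega
    · have := Int.emod_add_mul_ediv (-α.2 - (h - 1) * y - 1) h; linarith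
  have hjn' : ((h : ℝ) - 1) * y + j = h * n - α.2 := by exact_mod_cast hjn
  have hj1' : (1 : ℝ) ≤ j := by exact_mod_cast hj1
  have hj2' : (j : ℝ) ≤ h := by exact_mod_cast hj2
  have hd : 0 < D.2 - y := by linarith
  set t : ℝ := j / ((h - 1) * (D.2 - y)) with ht
  have htd : t * (D.2 - y) * (h - 1) = j := by rw [ht]; field_simp
  have ht0 : 0 < t := by rw [ht]; positivity
  have ht1 : t * (h - 1) * 3 ≤ j := by nlinarith [mul_pos ht0 hpos]
  have ht2 : t < 1 := by nlinarith
  have e1 := combo_mem_hull h₁ hD ht0.le ht2.le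
  have e2 := combo_mem_hull h₂ hD ht0.le ht2.le
  have := hfree.chord_le hh n (by linarith) e1 e2 h₁ hD (by simp only; nlinarith)
    (by simp only; nlinarith)
  nlinarith


/-- The affine map `(x, y) ↦ (a x + b y + e, c x + d y + f)` on integer points. -/
def affine (a b c d e f : ℤ) (v : ℤ × ℤ) : ℤ × ℤ :=
  (a * v.1 + b * v.2 + e, c * v.1 + d * v.2 + f)

/-- The affine map `(x, y) ↦ (a x + b y + e, c x + d y + f)` on real points. -/
def affineReal (a b c d e f : ℤ) (x : ℝ × ℝ) : ℝ × ℝ :=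
  (a * x.1 + b * x.2 + e, c * x.1 + d * x.2 + f)

theorem affineReal_toReal (a b c d e f : ℤ) (v : ℤ × ℤ) :
    affineReal a b c d e f (toReal v) = toReal (affine a b c d e f v) := by
  simp [affineReal, toReal, affine]

theorem hull_affine_image (a b c d e f : ℤ) {V : Set (ℤ × ℤ)} {x : ℝ × ℝ} (hx : x ∈ hull V) :
    affineReal a b c d e f x ∈ hull (affine a b c d e f '' V) := by
  have hc : Convex ℝ {y | affineReal a b c d e f y ∈ hull (affine a b c d e f '' V)} := by
    intro y hy z hz s t hs ht hst
    have := convex_hull _ hy hz hs ht hst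
    rw [mem_ofPred_eq]
    convert this using 1
    simp only [affineReal, Prod.ext_iff, Prod.fst_add, Prod.snd_add, Prod.smul_fst, Prod.smul_snd,
      smul_eq_mul]
    constructor
    · linear_combination -(e : ℝ) * hst
    · linear_combination -(f : ℝ) * hst
  refine convexHull_min ?_ hc hx
  rintro _ ⟨v, hv, rfl⟩
  rw [mem_ofPred_eq, affineReal_toReal]
  exact toReal_mem_hull (mem_image_of_mem _ hv)

theorem pullback_identity {a b c d ε : ℝ} (hε : a * d - b * c = ε) (hε2 : ε * ε = 1) (p q : ℝ) :
    ε * (p * d - q * c) * a + ε * (q * a - p * b) * c = p ∧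
      ε * (p * d - q * c) * b + ε * (q * a - p * b) * d = q := by
  subst hε
  constructor
  · linear_combination p * hε2
  · linear_combination q * hε2

section Transport

variable {a b c d e f ε : ℤ} (hε : a * d - b * c = ε) (hε2 : ε * ε = 1) {V : Set (ℤ × ℤ)}

include hε hε2

theorem inside_affine_iff {x : ℝ × ℝ} :
    Inside (affine a b c d e f '' V) (affineReal a b c d e f x) ↔ Inside V x := by
  have hε' : (a : ℝ) * d - b * c = ε := by exact_mod_cast hε
  have hε2' : (ε : ℝ) * ε = 1 := by exact_mod_cast hε2
  constructor
  · intro H p q hpq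
    obtain ⟨k₁, k₂⟩ := pullback_identity hε' hε2' p q
    obtain ⟨_, ⟨v, hv, rfl⟩, hlt⟩ := H (ε * (p * d - q * c)) (ε * (q * a - p * b)) (by
      by_contra! hcon
      rw [hcon.1, hcon.2] at k₁ k₂
      simp only [zero_mul, add_zero] at k₁ k₂
      exact hpq.elim (fun h => h k₁.symm) (fun h => h k₂.symm))
    refine ⟨v, hv, ?_⟩
    simp only [affine, affineReal] at hlt
    push_cast at hlt
    generalize (ε : ℝ) * (p * d - q * c) = P at *
    generalize (ε : ℝ) * (q * a - p * b) = Q at *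
    rw [← k₁, ← k₂]
    linarith
  · intro H p q hpq
    obtain ⟨v, hv, hlt⟩ := H (p * a + q * c) (p * b + q * d) (by
      by_contra! hcon
      have k₁ : ε * p = 0 := by rw [← hε']; linear_combination d * hcon.1 - c * hcon.2
      have k₂ : ε * q = 0 := by rw [← hε']; linear_combination a * hcon.2 - b * hcon.1
      have hε0 : (ε : ℝ) ≠ 0 := by rintro h0; rw [h0] at hε2'; simp at hε2'
      exact hpq.elim (fun h => h ((mul_eq_zero.1 k₁).resolve_left hε0))
        (fun h => h ((mul_eq_zero.1 k₂).resolve_left hε0)))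
    refine ⟨_, mem_image_of_mem _ hv, ?_⟩
    simp only [affine, affineReal]
    push_cast
    linarith

theorem covered_affine_iff {x : ℝ × ℝ} :
    Covered (affine a b c d e f '' V) (affineReal a b c d e f x) ↔ Covered V x := by
  have hε' : (a : ℝ) * d - b * c = ε := by exact_mod_cast hε
  have hε2' : (ε : ℝ) * ε = 1 := by exact_mod_cast hε2
  constructor
  · intro H p q
    obtain ⟨k₁, k₂⟩ := pullback_identity hε' hε2' p q
    obtain ⟨_, ⟨v, hv, rfl⟩, hlt⟩ := H (ε * (p * d - q * c)) (ε * (q * a - p * b))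
    refine ⟨v, hv, ?_⟩
    simp only [affine, affineReal] at hlt
    push_cast at hlt
    generalize (ε : ℝ) * (p * d - q * c) = P at *
    generalize (ε : ℝ) * (q * a - p * b) = Q at *
    rw [← k₁, ← k₂]
    linarith
  · intro H p q
    obtain ⟨v, hv, hlt⟩ := H (p * a + q * c) (p * b + q * d)
    refine ⟨_, mem_image_of_mem _ hv, ?_⟩
    simp only [affine, affineReal]
    push_cast
    linarith

theorem affine_bijective : Function.Bijective (affine a b c d e f) := by
  refine Function.bijective_iff_has_inverse.2
    ⟨fun w => (ε * (d * (w.1 - e) - b * (w.2 - f)), ε * (a * (w.2 - f) - c * (w.1 - e))), ?_, ?_⟩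
  · intro v
    subst hε
    ext
    · simp only [affine]; linear_combination v.1 * hε2
    · simp only [affine]; linear_combination v.2 * hε2
  · intro w
    subst hε
    ext
    · simp only [affine]; linear_combination (w.1 - e) * hε2
    · simp only [affine]; linear_combination (w.2 - f) * hε2

theorem Free.affine_image {h : ℤ} {α : ℤ × ℤ} (hh : 4 ≤ h) (hfree : Free V h α) :
    Free (affine a b c d e f '' V) h (affine a b c d e f α) := by
  intro k hk m n H
  have hh' : (4 : ℝ) ≤ h := by exact_mod_cast hh
  have hk' : (k : ℝ) ≤ 2 := by rcases hk with rfl | rfl <;> norm_num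
  have hpos : (h : ℝ) - k ≠ 0 := by linarith
  obtain ⟨⟨m', n'⟩, hmn⟩ := (affine_bijective (e := e) (f := f) hε hε2).2 (m, n)
  refine hfree k hk m' n' ((inside_affine_iff (e := e) (f := f) hε hε2).1 ?_)
  convert H using 1
  simp only [LatticePolygon.affine, Prod.mk.injEq] at hmn
  obtain ⟨rfl, rfl⟩ := hmn
  simp only [affineReal, LatticePolygon.affine, Prod.mk.injEq]
  push_cast
  constructor
  · field_simp; ring
  · field_simp; ring

theorem WidthGe.affine_image {n : ℤ} (hV : WidthGe V n) :
    WidthGe (affine a b c d e f '' V) n := by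
  intro p q hpq
  obtain ⟨v, hv, w, hw, hle⟩ := hV (p * a + q * c) (p * b + q * d) (by
    by_contra! hcon
    have k₁ : ε * p = 0 := by rw [← hε]; linear_combination d * hcon.1 - c * hcon.2
    have k₂ : ε * q = 0 := by rw [← hε]; linear_combination a * hcon.2 - b * hcon.1
    have hε0 : ε ≠ 0 := by rintro rfl; simp at hε2
    exact hpq.elim (fun h => h ((mul_eq_zero.1 k₁).resolve_left hε0))
      (fun h => h ((mul_eq_zero.1 k₂).resolve_left hε0)))
  refine ⟨_, mem_image_of_mem _ hv, _, mem_image_of_mem _ hw, ?_⟩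
  simp only [LatticePolygon.affine]
  linarith

end Transport


theorem exists_le_of_mem_hull_of_min {V : Set (ℤ × ℤ)} (hfin : V.Finite) {x : ℝ} {y : ℤ}
    (hx : (x, (y : ℝ)) ∈ hull V) (hmin : ∀ v ∈ V, y ≤ v.2) :
    (∃ v ∈ V, v.2 = y ∧ (v.1 : ℝ) ≤ x) ∧ ∃ v ∈ V, v.2 = y ∧ x ≤ (v.1 : ℝ) := by
  have hne : V.Nonempty := by
    obtain ⟨v, hv, -⟩ := covered_of_mem_hull hx 0 0
    exact ⟨v, hv⟩
  constructor
  · obtain ⟨u, -, hu⟩ := exists_min_image V (fun v => v.1) hfin hne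
    obtain ⟨v, hv, hle⟩ := covered_of_mem_hull hx (-1) (-(|x - u.1| + 1))
    have h1 : (u.1 : ℝ) ≤ v.1 := by exact_mod_cast hu v hv
    have h2 := le_abs_self (x - u.1)
    have h3 := abs_nonneg (x - u.1)
    have h4 : v.2 = y := by
      by_contra hne
      have h5 : y + 1 ≤ v.2 := by have := hmin v hv; omega
      have h6 : (y : ℝ) + 1 ≤ v.2 := by exact_mod_cast h5
      simp only at hle
      nlinarith
    refine ⟨v, hv, h4, ?_⟩
    rw [h4] at hle
    simp only at hle
    linarith
  · obtain ⟨u, -, hu⟩ := exists_max_image V (fun v => v.1) hfin hne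
    obtain ⟨v, hv, hle⟩ := covered_of_mem_hull hx 1 (-(|u.1 - x| + 1))
    have h1 : (v.1 : ℝ) ≤ u.1 := by exact_mod_cast hu v hv
    have h2 := le_abs_self (u.1 - x)
    have h3 := abs_nonneg (u.1 - x)
    have h4 : v.2 = y := by
      by_contra hne
      have h5 : y + 1 ≤ v.2 := by have := hmin v hv; omega
      have h6 : (y : ℝ) + 1 ≤ v.2 := by exact_mod_cast h5
      simp only at hle
      nlinarith
    refine ⟨v, hv, h4, ?_⟩
    rw [h4] at hle
    simp only at hle
    linarith

theorem Free.chord_le_two_of_upper {V : Set (ℤ × ℤ)} {h : ℤ} {α : ℤ × ℤ} (hfree : Free V h α)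
    (hfin : V.Finite) (hh : 4 ≤ h) {x₁ x₂ : ℝ} {y : ℤ}
    (h₁ : (x₁, (y : ℝ)) ∈ hull V) (h₂ : (x₂, (y : ℝ)) ∈ hull V) {s t : ℤ × ℤ} (hs : s ∈ V)
    (ht : t ∈ V) (hmin : ∀ v ∈ V, t.2 ≤ v.2) (hty : t.2 ≤ y) (hst : t.2 + 3 ≤ s.2)
    (hsy : y + 2 ≤ s.2) : x₂ - x₁ ≤ 2 := by
  rcases hty.eq_or_lt with rfl | hlt
  · obtain ⟨v, hv, hvy, hvx⟩ := (exists_le_of_mem_hull_of_min hfin h₁ hmin).1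
    obtain ⟨w, hw, hwy, hwx⟩ := (exists_le_of_mem_hull_of_min hfin h₂ hmin).2
    have key := hfree.edge_lt_three hh (x₁ := v.1) (x₂ := w.1) (y := t.2) (D := toReal s)
      (by rw [← hvy]; exact toReal_mem_hull hv) (by rw [← hwy]; exact toReal_mem_hull hw)
      (toReal_mem_hull hs) (by simp only [toReal]; exact_mod_cast hst)
    have : w.1 - v.1 < 3 := by exact_mod_cast key
    have : w.1 - v.1 ≤ 2 := by omega
    have : (w.1 : ℝ) - v.1 ≤ 2 := by exact_mod_cast this
    linarith
  · refine hfree.chord_le_two hh h₁ h₂ (toReal_mem_hull ht) (toReal_mem_hull hs) ?_ ?_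
    · have : t.2 ≤ y - 1 := by omega
      simp only [toReal]; exact_mod_cast this
    · simp only [toReal]; exact_mod_cast hsy

/-- If all lattice widths are at least `3`, horizontal chords at integer heights have length
at most `2`. -/
theorem Free.chord_le_two_of_width {V : Set (ℤ × ℤ)} {h : ℤ} {α : ℤ × ℤ} (hfree : Free V h α)
    (hfin : V.Finite) (hW : WidthGe V 3) (hh : 4 ≤ h) {x₁ x₂ : ℝ} {y : ℤ}
    (h₁ : (x₁, (y : ℝ)) ∈ hull V) (h₂ : (x₂, (y : ℝ)) ∈ hull V) : x₂ - x₁ ≤ 2 := by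
  obtain ⟨v, hv, w, hw, hvw⟩ := hW 0 1 (by simp)
  obtain ⟨t, ht, hmin⟩ := exists_min_image V (fun v => v.2) hfin ⟨v, hv⟩
  obtain ⟨s, hs, hmax⟩ := exists_max_image V (fun v => v.2) hfin ⟨v, hv⟩
  have hst : t.2 + 3 ≤ s.2 := by have := hmin w hw; have := hmax v hv; omega
  have hys : y ≤ s.2 := by
    obtain ⟨u, hu, hle⟩ := covered_of_mem_hull h₁ 0 1
    have : y ≤ u.2 := by simp only [zero_mul, one_mul, zero_add] at hle; exact_mod_cast hle
    exact this.trans (hmax u hu)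
  have hty : t.2 ≤ y := by
    obtain ⟨u, hu, hle⟩ := covered_of_mem_hull h₁ 0 (-1)
    have : u.2 ≤ y := by
      simp only [zero_mul, neg_mul, one_mul, zero_add, neg_le_neg_iff] at hle; exact_mod_cast hle
    exact (hmin u hu).trans this
  by_cases hsy : y + 2 ≤ s.2
  · exact hfree.chord_le_two_of_upper hfin hh h₁ h₂ hs ht hmin hty hst hsy
  · have hε : (1 : ℤ) * (-1) - 0 * 0 = -1 := by norm_num
    have hε2 : (-1 : ℤ) * (-1) = 1 := by norm_num
    refine (hfree.affine_image (e := 0) (f := 0) hε hε2 hh).chord_le_two_of_upper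
      (hfin.image _) hh (x₁ := x₁) (x₂ := x₂) (y := -y) ?_ ?_
      (mem_image_of_mem _ ht) (mem_image_of_mem _ hs) ?_ ?_ ?_ ?_
    · simpa [affineReal] using hull_affine_image 1 0 0 (-1) 0 0 h₁
    · simpa [affineReal] using hull_affine_image 1 0 0 (-1) 0 0 h₂
    · rintro _ ⟨u, hu, rfl⟩
      have := hmax u hu
      simp only [LatticePolygon.affine]; omega
    all_goals simp only [LatticePolygon.affine]; omega

/-- No two points of `V` differ by three or more steps in a lattice direction. -/
theorem Free.lattice_chord_le_two {V : Set (ℤ × ℤ)} {h : ℤ} {α : ℤ × ℤ} (hfree : Free V h α)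
    (hfin : V.Finite) (hW : WidthGe V 3) (hh : 4 ≤ h) {a b c d : ℤ} (hdet : a * d - b * c = 1)
    {v w : ℤ × ℤ} (hv : v ∈ V) (hw : w ∈ V)
    (hy : c * (w.1 - v.1) + d * (w.2 - v.2) = 0) :
    a * (w.1 - v.1) + b * (w.2 - v.2) ≤ 2 := by
  have h1 : (1 : ℤ) * 1 = 1 := by norm_num
  have hy' : c * w.1 + d * w.2 + 0 = c * v.1 + d * v.2 + 0 := by linarith
  have hw' : affine a b c d 0 0 w = (a * w.1 + b * w.2 + 0, c * v.1 + d * v.2 + 0) := by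
    simp only [LatticePolygon.affine, hy']
  have key := (hfree.affine_image (e := 0) (f := 0) hdet h1 hh).chord_le_two_of_width
    (hfin.image _) (hW.affine_image hdet h1) hh
    (toReal_mem_hull (mem_image_of_mem _ hv))
    (by have := toReal_mem_hull (mem_image_of_mem (affine a b c d 0 0) hw)
        rw [hw'] at this
        exact this)
  have key' : (a * w.1 + b * w.2 + 0) - (a * v.1 + b * v.2 + 0) ≤ 2 := by
    simp only [LatticePolygon.affine] at key
    exact_mod_cast key
  linarith


theorem exists_slices_of_mem_hull {V : Set (ℤ × ℤ)} {x : ℝ × ℝ} (hx : x ∈ hull V) {k : ℤ}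
    (h₁ : (k : ℝ) < x.2) (h₂ : x.2 < k + 1) :
    ∃ b c : ℝ, (b, (k : ℝ)) ∈ hull V ∧ (c, (k : ℝ) + 1) ∈ hull V ∧
      x.1 = (k + 1 - x.2) * b + (x.2 - k) * c := by
  set L : Set (ℤ × ℤ) := {v ∈ V | v.2 ≤ k} with hL
  set U : Set (ℤ × ℤ) := {v ∈ V | k + 1 ≤ v.2} with hU
  have hLne : L.Nonempty := by
    obtain ⟨v, hv, hle⟩ := covered_of_mem_hull hx 0 (-1)
    refine ⟨v, hv, ?_⟩
    have : (v.2 : ℝ) < k + 1 := by linarith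
    have : v.2 < k + 1 := by exact_mod_cast this
    omega
  have hUne : U.Nonempty := by
    obtain ⟨v, hv, hle⟩ := covered_of_mem_hull hx 0 1
    refine ⟨v, hv, ?_⟩
    have : (k : ℝ) < v.2 := by linarith
    have : k < v.2 := by exact_mod_cast this
    omega
  have hVLU : toReal '' V = toReal '' L ∪ toReal '' U := by
    rw [← image_union]
    congr 1
    ext v
    simp only [hL, hU, mem_union, mem_ofPred_eq]
    constructor
    · intro hv
      rcases le_or_gt v.2 k with h | h
      · exact Or.inl ⟨hv, h⟩
      · exact Or.inr ⟨hv, h⟩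
    · rintro (h | h) <;> exact h.1
  have hx' := hx
  rw [hull, hVLU, convexHull_union (hLne.image _) (hUne.image _), mem_convexJoin] at hx'
  obtain ⟨B, hB, C, hC, s, t, hs, ht, hst, hBC⟩ := hx'
  have hB2 : B.2 ≤ k := by
    have := hull_le (V := L) (p := 0) (q := 1) (r := k)
      (fun v hv => by have : (v.2 : ℝ) ≤ k := by exact_mod_cast hv.2
                      linarith) hB
    linarith
  have hC2 : (k : ℝ) + 1 ≤ C.2 := by
    have := hull_le (V := U) (p := 0) (q := -1) (r := -(k + 1))
      (fun v hv => by have : (k : ℝ) + 1 ≤ v.2 := by exact_mod_cast hv.2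
                      linarith) hC
    linarith
  have hBV : B ∈ hull V := convexHull_mono (by rw [hVLU]; exact subset_union_left) hB
  have hCV : C ∈ hull V := convexHull_mono (by rw [hVLU]; exact subset_union_right) hC
  have hd : 0 < C.2 - B.2 := by linarith
  have hs' : s = 1 - t := by linarith
  subst hs'
  have hx1 : x.1 = (1 - t) * B.1 + t * C.1 := by rw [← hBC]; simp
  have hx2 : x.2 = (1 - t) * B.2 + t * C.2 := by rw [← hBC]; simp
  have e1 := combo_mem_hull hBV hCV (t := (k - B.2) / (C.2 - B.2))
    (div_nonneg (by linarith) hd.le) (by rw [div_le_one hd]; linarith)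
  have e2 := combo_mem_hull hBV hCV (t := (k + 1 - B.2) / (C.2 - B.2))
    (div_nonneg (by linarith) hd.le) (by rw [div_le_one hd]; linarith)
  have f1 : (1 - (k - B.2) / (C.2 - B.2)) * B.2 + (k - B.2) / (C.2 - B.2) * C.2 = k := by
    field_simp; ring
  have f2 : (1 - (k + 1 - B.2) / (C.2 - B.2)) * B.2 + (k + 1 - B.2) / (C.2 - B.2) * C.2
      = k + 1 := by
    field_simp; ring
  rw [f1] at e1
  rw [f2] at e2
  refine ⟨_, _, e1, e2, ?_⟩
  rw [hx1, hx2]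
  field_simp
  ring

theorem Free.real_chord_le_two {V : Set (ℤ × ℤ)} {h : ℤ} {α : ℤ × ℤ} (hfree : Free V h α)
    (hfin : V.Finite) (hW : WidthGe V 3) (hh : 4 ≤ h) {x₁ x₂ y : ℝ}
    (h₁ : (x₁, y) ∈ hull V) (h₂ : (x₂, y) ∈ hull V) : x₂ - x₁ ≤ 2 := by
  rcases (Int.floor_le y).eq_or_lt with hy | hy
  · rw [← hy] at h₁ h₂
    exact hfree.chord_le_two_of_width hfin hW hh h₁ h₂
  · have hy' := Int.lt_floor_add_one y
    obtain ⟨b₁, c₁, hb₁, hc₁, e₁⟩ := exists_slices_of_mem_hull h₁ hy hy'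
    obtain ⟨b₂, c₂, hb₂, hc₂, e₂⟩ := exists_slices_of_mem_hull h₂ hy hy'
    have k₁ := hfree.chord_le_two_of_width hfin hW hh hb₁ hb₂
    have k₂ := hfree.chord_le_two_of_width hfin hW hh (y := ⌊y⌋ + 1) (by exact_mod_cast hc₁)
      (by exact_mod_cast hc₂)
    simp only at e₁ e₂
    rw [e₁, e₂]
    nlinarith

/-- A finite set whose hull has no horizontal chord of length `ℓ` lies in a strip of
horizontal width less than `ℓ`. -/
theorem exists_strip {V : Set (ℤ × ℤ)} (hfin : V.Finite) {l : ℝ} (hl : 0 < l)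
    (hchord : ∀ x₁ x₂ y : ℝ, (x₁, y) ∈ hull V → (x₂, y) ∈ hull V → x₂ - x₁ < l) :
    ∃ σ : ℝ, ∀ v ∈ V, ∀ w ∈ V, ((v.1 : ℝ) - w.1) - σ * (v.2 - w.2) < l := by
  rcases V.eq_empty_or_nonempty with rfl | ⟨v₀, hv₀⟩
  · exact ⟨0, by simp⟩
  have hcomp : IsCompact (hull V) := (hfin.image _).isCompact_convexHull ℝ
  have hdisj : Disjoint (hull V) ((fun x : ℝ × ℝ => x + (l, 0)) '' hull V) := by
    rw [Set.disjoint_left]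
    rintro _ hx ⟨⟨a, b⟩, hy, rfl⟩
    have := hchord a (a + l) b hy (by simpa using hx)
    linarith
  have hconv : Convex ℝ ((fun x : ℝ × ℝ => x + (l, 0)) '' hull V) := by
    simpa [add_comm] using (convex_hull V).translate ((l, 0) : ℝ × ℝ)
  obtain ⟨f, u, u', hfu, huu', hfv⟩ := geometric_hahn_banach_compact_closed (convex_hull V) hcomp
    hconv (hcomp.image (by fun_prop)).isClosed hdisj
  have hf : ∀ x : ℝ × ℝ, f x = f (1, 0) * x.1 + f (0, 1) * x.2 := by
    intro x
    have : x = x.1 • ((1, 0) : ℝ × ℝ) + x.2 • ((0, 1) : ℝ × ℝ) := by ext <;> simp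
    conv_lhs => rw [this, map_add, map_smul, map_smul, smul_eq_mul, smul_eq_mul]
    ring
  have hpair : ∀ v ∈ V, ∀ w ∈ V,
      f (1, 0) * v.1 + f (0, 1) * v.2 < f (1, 0) * (w.1 + l) + f (0, 1) * w.2 := by
    intro v hv w hw
    have h1 := hfu _ (toReal_mem_hull hv)
    have h2 := hfv _ (mem_image_of_mem _ (toReal_mem_hull hw))
    rw [hf] at h1 h2
    simp only [toReal, Prod.fst_add, Prod.snd_add, add_zero] at h1 h2
    linarith
  have hp : 0 < f (1, 0) := by
    have := hpair v₀ hv₀ v₀ hv₀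
    by_contra! hneg
    nlinarith
  refine ⟨-(f (0, 1) / f (1, 0)), fun v hv w hw => ?_⟩
  have := hpair v hv w hw
  have e : f (1, 0) * (((v.1 : ℝ) - w.1) - -(f (0, 1) / f (1, 0)) * (v.2 - w.2)) =
      f (1, 0) * (v.1 - w.1) + f (0, 1) * (v.2 - w.2) := by
    field_simp
    ring
  refine lt_of_mul_lt_mul_left ?_ hp.le
  rw [e]
  linarith

/-- Points of large width in a narrow strip contain a long lattice chord. -/
theorem exists_lattice_chord_of_strip {V : Set (ℤ × ℤ)} {ω : ℤ} (hω : 3 ≤ ω)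
    (hW : WidthGe V ω) (hy : ∀ v ∈ V, ∀ w ∈ V, v.2 - w.2 ≤ ω) {σ : ℝ} (hσ0 : 0 ≤ σ)
    (hσ : σ ≤ 1 / 2)
    (hstrip : ∀ v ∈ V, ∀ w ∈ V, ((v.1 : ℝ) - w.1) - σ * (v.2 - w.2) < 21 / 10) :
    ∃ v ∈ V, ∃ w ∈ V, (w.1 - v.1 = 0 ∧ w.2 - v.2 = 3) ∨
      (3 ≤ w.1 - v.1 ∧ w.2 - v.2 = w.1 - v.1) := by
  obtain ⟨r, hr, l, hl, hrl⟩ := hW 1 0 (by simp)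
  have hyR : ∀ v ∈ V, ∀ w ∈ V, (v.2 : ℝ) - w.2 ≤ ω := fun v hv w hw => by
    exact_mod_cast hy v hv w hw
  have hωR : (3 : ℝ) ≤ ω := by exact_mod_cast hω
  have hbound : ∀ v ∈ V, ∀ w ∈ V, ((v.1 : ℝ) - w.1) < 21 / 10 + ω / 2 := by
    intro v hv w hw
    have h1 := hstrip v hv w hw
    have h2 := hyR v hv w hw
    nlinarith
  have hrlR : (ω : ℝ) ≤ r.1 - l.1 := by
    have : ω ≤ r.1 - l.1 := by linarith
    exact_mod_cast this
  have hω4 : ω ≤ 4 := by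
    have := hbound r hr l hl
    have : (ω : ℝ) < 5 := by linarith
    have : ω < 5 := by exact_mod_cast this
    omega
  have hrls := hstrip r hr l hl
  have hdy0 : (0 : ℝ) ≤ r.2 - l.2 := by
    by_contra! hneg
    nlinarith
  have hdy : (2 : ℝ) * ω - 42 / 10 < r.2 - l.2 := by nlinarith
  have hylr := hy r hr l hl
  rcases (by omega : ω = 4 ∨ ω = 3) with rfl | rfl
  · push_cast at hdy
    have h1 : (3 : ℝ) < r.2 - l.2 := by linarith
    have h1 : 3 < r.2 - l.2 := by exact_mod_cast h1
    have h2 := hbound r hr l hl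
    push_cast at h2
    have h2 : (r.1 : ℝ) - l.1 < 5 := by linarith
    have h2 : r.1 - l.1 < 5 := by exact_mod_cast h2
    exact ⟨l, hl, r, hr, Or.inr ⟨by omega, by omega⟩⟩
  · push_cast at hdy
    have h1 : (1 : ℝ) < r.2 - l.2 := by linarith
    have h1 : 1 < r.2 - l.2 := by exact_mod_cast h1
    have hx : ∀ v ∈ V, ∀ w ∈ V, v.1 - w.1 ≤ 3 := by
      intro v hv w hw
      have h2 := hbound v hv w hw
      push_cast at h2
      have h2 : (v.1 : ℝ) - w.1 < 4 := by linarith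
      have h2 : v.1 - w.1 < 4 := by exact_mod_cast h2
      omega
    have hrl1 := hx r hr l hl
    rcases (by omega : r.2 - l.2 = 3 ∨ r.2 - l.2 = 2) with hd | hd
    · exact ⟨l, hl, r, hr, Or.inr ⟨by omega, by omega⟩⟩
    · have hdR : (r.2 : ℝ) - l.2 = 2 := by exact_mod_cast hd
      have hdx : r.1 - l.1 = 3 := by omega
      have hdxR : (r.1 : ℝ) - l.1 = 3 := by exact_mod_cast hdx
      rw [hdR, hdxR] at hrls
      have hmain : ∀ v ∈ V, 0 ≤ 2 * (v.1 - l.1) - (v.2 - l.2) ∧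
          2 * (v.1 - l.1) - (v.2 - l.2) ≤ 4 := by
        intro v hv
        have k1 := hstrip v hv l hl
        have k2 := hstrip r hr v hv
        have k3 := hyR v hv l hl
        have k4 := hyR l hl v hv
        push_cast at k3 k4
        have k5 : (-1 : ℝ) < 2 * (v.1 - l.1) - (v.2 - l.2) := by nlinarith
        have k6 : 2 * ((v.1 : ℝ) - l.1) - (v.2 - l.2) < 5 := by nlinarith
        have k5 : -1 < 2 * (v.1 - l.1) - (v.2 - l.2) := by exact_mod_cast k5
        have k6 : 2 * (v.1 - l.1) - (v.2 - l.2) < 5 := by exact_mod_cast k6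
        omega
      obtain ⟨u, hu, w, hw, huw⟩ := hW 0 1 (by simp)
      obtain ⟨s, hs, t, ht, hst⟩ := hW 1 (-1) (by simp)
      have hmu := hmain u hu
      have hmw := hmain w hw
      have hms := hmain s hs
      have hmt := hmain t ht
      have y1 := hy u hu l hl
      have y2 := hy r hr w hw
      have y3 := hy u hu w hw
      have y4 := hy u hu s hs
      have y5 := hy u hu t ht
      have y6 := hy s hs w hw
      have y7 := hy t ht w hw
      have x1 := hx u hu l hl
      have x2 := hx r hr u hu
      have x3 := hx w hw l hl
      have x4 := hx r hr w hw
      have x5 := hx s hs l hl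
      have x6 := hx r hr s hs
      have x7 := hx t ht l hl
      have x8 := hx r hr t ht
      rcases (by omega : w.2 = l.2 ∨ w.2 = l.2 - 1) with hw2 | hw2
      · rcases (by omega : u.1 - l.1 = 3 ∨ u.1 - l.1 = 2) with hu1 | hu1
        · exact ⟨l, hl, u, hu, Or.inr ⟨by omega, by omega⟩⟩
        · exact ⟨s, hs, u, hu, Or.inl ⟨by omega, by omega⟩⟩
      · rcases (by omega : w.1 - l.1 = 0 ∨ w.1 - l.1 = 1) with hw1 | hw1
        · exact ⟨w, hw, r, hr, Or.inr ⟨by omega, by omega⟩⟩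
        · exact ⟨w, hw, t, ht, Or.inl ⟨by omega, by omega⟩⟩


theorem exists_primitive_of_width {V : Set (ℤ × ℤ)} {n : ℤ} (hn : 1 ≤ n) (hW : WidthGe V n)
    (hW' : ¬ WidthGe V (n + 1)) :
    ∃ a b c d : ℤ, a * d - b * c = 1 ∧
      ∀ v ∈ V, ∀ w ∈ V, c * (v.1 - w.1) + d * (v.2 - w.2) ≤ n := by
  simp only [WidthGe, not_forall] at hW'
  obtain ⟨p, q, hpq, hle⟩ := hW'
  push Not at hle
  have hg0 : 0 < p.gcd q := Int.gcd_pos_iff.2 hpq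
  obtain ⟨p', hp'⟩ := Int.gcd_dvd_left p q
  obtain ⟨q', hq'⟩ := Int.gcd_dvd_right p q
  have hpq' : p' ≠ 0 ∨ q' ≠ 0 := by
    by_contra! hcon
    rw [hcon.1, mul_zero] at hp'
    rw [hcon.2, mul_zero] at hq'
    exact hpq.elim (fun h => h hp') (fun h => h hq')
  obtain ⟨v, hv, w, hw, hvw⟩ := hW p' q' hpq'
  have hlt := hle v hv w hw
  have hg1 : p.gcd q = 1 := by
    by_contra hne
    have h2 : (2 : ℤ) ≤ (p.gcd q : ℤ) := by exact_mod_cast (by omega : 2 ≤ p.gcd q)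
    generalize (p.gcd q : ℤ) = g at *
    rw [hp', hq'] at hlt
    nlinarith
  have hb := Int.gcd_eq_gcd_ab p q
  rw [hg1] at hb
  push_cast at hb
  exact ⟨p.gcdB q, -p.gcdA q, p, q, by linarith, fun v hv w hw => by
    have := hle v hv w hw; omega⟩

/-- A lattice-free pyramid of height at least `4` has a base of lattice width less than `3`. -/
theorem Free.not_widthGe_three {V : Set (ℤ × ℤ)} {h : ℤ} {α : ℤ × ℤ} (hfree : Free V h α)
    (hfin : V.Finite) (hh : 4 ≤ h) : ¬ WidthGe V 3 := by
  intro hW3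
  obtain ⟨v, hv, -, -, -⟩ := hW3 1 0 (by simp)
  obtain ⟨t, ht, hmin⟩ := exists_min_image V (fun v => v.2) hfin ⟨v, hv⟩
  obtain ⟨s, hs, hmax⟩ := exists_max_image V (fun v => v.2) hfin ⟨v, hv⟩
  obtain ⟨ω, hω, hωmax⟩ := Int.exists_greatest_of_bdd (P := WidthGe V)
    ⟨s.2 - t.2, fun n hn => by
      obtain ⟨v, hv, w, hw, hvw⟩ := hn 0 1 (by simp)
      have := hmax v hv
      have := hmin w hw
      omega⟩ ⟨3, hW3⟩
  have hω3 := hωmax 3 hW3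
  obtain ⟨a, b, c, d, hdet, hcd⟩ := exists_primitive_of_width (by omega) hω
    (fun hcon => by have := hωmax _ hcon; omega)
  have h1 : (1 : ℤ) * 1 = 1 := by norm_num
  have hfree₁ := hfree.affine_image (e := 0) (f := 0) hdet h1 hh
  have hW₁ := hω.affine_image (e := 0) (f := 0) hdet h1
  have hfin₁ := hfin.image (affine a b c d 0 0)
  have hy₁ : ∀ v ∈ affine a b c d 0 0 '' V, ∀ w ∈ affine a b c d 0 0 '' V, v.2 - w.2 ≤ ω := by
    rintro _ ⟨v, hv, rfl⟩ _ ⟨w, hw, rfl⟩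
    have := hcd v hv w hw
    simp only [LatticePolygon.affine]
    linarith
  generalize affine a b c d 0 0 '' V = V₁ at *
  generalize affine a b c d 0 0 α = α₁ at *
  have mono : ∀ V', WidthGe V' ω → WidthGe V' 3 := fun V' hV' p q hpq => by
    obtain ⟨v, hv, w, hw, hvw⟩ := hV' p q hpq
    exact ⟨v, hv, w, hw, hω3.trans hvw⟩
  obtain ⟨σ, hσ⟩ := exists_strip hfin₁ (l := 21 / 10) (by norm_num)
    (fun x₁ x₂ y h₁ h₂ => by
      have := hfree₁.real_chord_le_two hfin₁ (mono _ hW₁) hh h₁ h₂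
      linarith)
  obtain ⟨τ, ε, hε, hτ0, hτ, hτσ⟩ : ∃ (τ : ℝ) (ε : ℤ), ε * ε = 1 ∧ 0 ≤ τ ∧ τ ≤ 1 / 2 ∧
      σ - round σ = τ * ε := by
    have habs := abs_sub_round σ
    rcases le_total 0 (σ - round σ) with hs | hs
    · exact ⟨σ - round σ, 1, by norm_num, hs, by rwa [abs_of_nonneg hs] at habs, by simp⟩
    · exact ⟨-(σ - round σ), -1, by norm_num, by linarith, by rwa [abs_of_nonpos hs] at habs,
        by simp⟩
  have hdet₂ : (1 : ℤ) * ε - (-round σ) * 0 = ε := by ring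
  have hfree₂ := hfree₁.affine_image (e := 0) (f := 0) hdet₂ hε hh
  have hW₂ := hW₁.affine_image (e := 0) (f := 0) hdet₂ hε
  have hεR : (ε : ℝ) * ε = 1 := by exact_mod_cast hε
  obtain ⟨v, hv, w, hw, hvw⟩ := exists_lattice_chord_of_strip hω3 hW₂ (by
      rintro _ ⟨v, hv, rfl⟩ _ ⟨w, hw, rfl⟩
      have k1 := hy₁ v hv w hw
      have k2 := hy₁ w hw v hv
      simp only [LatticePolygon.affine]
      rcases mul_self_eq_one_iff.1 hε with rfl | rfl <;> linarith) hτ0 hτ (by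
      rintro _ ⟨v, hv, rfl⟩ _ ⟨w, hw, rfl⟩
      have := hσ v hv w hw
      simp only [LatticePolygon.affine]
      push_cast
      have e : σ = round σ + τ * ε := by linarith
      rw [e] at this
      generalize (round σ : ℝ) = R at *
      linarith)
  rcases hvw with ⟨hx, hy⟩ | ⟨hx, hy⟩
  · have := hfree₂.lattice_chord_le_two (hfin₁.image _) (mono _ hW₂) hh (a := 0) (b := 1)
      (c := -1) (d := 0) (by norm_num) hv hw (by linarith)
    linarith
  · have := hfree₂.lattice_chord_le_two (hfin₁.image _) (mono _ hW₂) hh (a := 1) (b := 0)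
      (c := -1) (d := 1) (by norm_num) hv hw (by linarith)
    linarith

theorem widthGe_two_of_inside {V : Set (ℤ × ℤ)} {z : ℤ × ℤ} (hz : Inside V (toReal z)) :
    WidthGe V 2 := by
  intro p q hpq
  have hpq' : (p : ℝ) ≠ 0 ∨ (q : ℝ) ≠ 0 := by exact_mod_cast hpq
  obtain ⟨v, hv, h1⟩ := hz p q hpq'
  obtain ⟨w, hw, h2⟩ := hz (-p) (-q) (by simpa using hpq')
  simp only [toReal] at h1 h2
  have h1' : p * z.1 + q * z.2 < p * v.1 + q * v.2 := by exact_mod_cast h1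
  have h2' : -p * z.1 + -q * z.2 < -p * w.1 + -q * w.2 := by exact_mod_cast h2
  refine ⟨v, hv, w, hw, ?_⟩
  nlinarith


/-- The integer points strictly inside the hull of `V`. -/
def innerPts (V : Set (ℤ × ℤ)) : Set (ℤ × ℤ) := {z | Inside V (toReal z)}

/-- The integer points on the boundary of the hull of `V`. -/
def boundaryPts (V : Set (ℤ × ℤ)) : Set (ℤ × ℤ) :=
  {z | Covered V (toReal z) ∧ ¬ Inside V (toReal z)}

theorem covered_of_inside {V : Set (ℤ × ℤ)} {z : ℤ × ℤ} (hz : Inside V (toReal z)) :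
    Covered V (toReal z) := by
  intro p q
  by_cases hpq : p ≠ 0 ∨ q ≠ 0
  · obtain ⟨v, hv, hlt⟩ := hz p q hpq
    exact ⟨v, hv, hlt.le⟩
  · push Not at hpq
    obtain ⟨v, hv, -⟩ := hz 1 0 (by simp)
    exact ⟨v, hv, by simp [hpq.1, hpq.2]⟩

/-- The horizontal sections of a polygon contained in the strip `0 ≤ y ≤ 2`: the sections at
heights `0` and `2` are `[a₀, b₀]` and `[a₂, b₂]`, the section at height `1` is `[P / 2, Q / 2]`. -/
structure StripData (V : Set (ℤ × ℤ)) (a₀ b₀ a₂ b₂ P Q : ℤ) : Prop where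
  mem_a₀ : (a₀, 0) ∈ V
  mem_b₀ : (b₀, 0) ∈ V
  mem_a₂ : (a₂, 2) ∈ V
  mem_b₂ : (b₂, 2) ∈ V
  mem_P : ((P : ℝ) / 2, 1) ∈ hull V
  mem_Q : ((Q : ℝ) / 2, 1) ∈ hull V
  le_P : P ≤ a₀ + a₂
  Q_le : b₀ + b₂ ≤ Q
  cases : ∀ v ∈ V, (v.2 = 0 ∧ a₀ ≤ v.1 ∧ v.1 ≤ b₀) ∨ (v.2 = 2 ∧ a₂ ≤ v.1 ∧ v.1 ≤ b₂) ∨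
    (v.2 = 1 ∧ P ≤ 2 * v.1 ∧ 2 * v.1 ≤ Q)

theorem half_sum_mem_hull {V : Set (ℤ × ℤ)} {x₀ x₂ : ℤ} (h₀ : (x₀, 0) ∈ V) (h₂ : (x₂, 2) ∈ V) :
    (((x₀ + x₂ : ℤ) : ℝ) / 2, (1 : ℝ)) ∈ hull V := by
  have := combo_mem_hull (toReal_mem_hull h₀) (toReal_mem_hull h₂) (t := 1 / 2)
    (by norm_num) (by norm_num)
  convert this using 2
  · simp only [toReal]; push_cast; ring
  · simp only [toReal]; norm_num

theorem exists_stripData {V : Set (ℤ × ℤ)} (hfin : V.Finite)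
    (hy : ∀ v ∈ V, 0 ≤ v.2 ∧ v.2 ≤ 2) (h0 : ∃ v ∈ V, v.2 = 0) (h2 : ∃ v ∈ V, v.2 = 2) :
    ∃ a₀ b₀ a₂ b₂ P Q : ℤ, StripData V a₀ b₀ a₂ b₂ P Q := by
  have row : ∀ k : ℤ, (∃ v ∈ V, v.2 = k) → ∃ a b : ℤ, (a, k) ∈ V ∧ (b, k) ∈ V ∧
      ∀ v ∈ V, v.2 = k → a ≤ v.1 ∧ v.1 ≤ b := by
    rintro k ⟨v, hv, hvk⟩
    have hf : {v ∈ V | v.2 = k}.Finite := hfin.subset (sep_subset _ _)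
    obtain ⟨⟨a, y⟩, ⟨ha, rfl⟩, hmin⟩ := exists_min_image _ (fun v => v.1) hf ⟨v, hv, hvk⟩
    obtain ⟨⟨b, y'⟩, ⟨hb, hb'⟩, hmax⟩ := exists_max_image _ (fun v => v.1) hf ⟨v, hv, hvk⟩
    simp only at hb'
    subst hb'
    exact ⟨a, b, ha, hb, fun w hw hwk => ⟨hmin w ⟨hw, hwk⟩, hmax w ⟨hw, hwk⟩⟩⟩
  obtain ⟨a₀, b₀, ha₀, hb₀, h₀⟩ := row 0 h0
  obtain ⟨a₂, b₂, ha₂, hb₂, h₂⟩ := row 2 h2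
  have hmid : ∃ P Q : ℤ, ((P : ℝ) / 2, (1 : ℝ)) ∈ hull V ∧ ((Q : ℝ) / 2, (1 : ℝ)) ∈ hull V ∧
      P ≤ a₀ + a₂ ∧ b₀ + b₂ ≤ Q ∧ ∀ v ∈ V, v.2 = 1 → P ≤ 2 * v.1 ∧ 2 * v.1 ≤ Q := by
    by_cases h1 : ∃ v ∈ V, v.2 = 1
    · obtain ⟨a₁, b₁, ha₁, hb₁, h₁⟩ := row 1 h1
      have ha := toReal_mem_hull ha₁
      have hb := toReal_mem_hull hb₁
      have key : ∀ x : ℤ, toReal (x, 1) ∈ hull V → (((2 * x : ℤ) : ℝ) / 2, (1 : ℝ)) ∈ hull V := by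
        intro x hx
        have e : (((2 * x : ℤ) : ℝ) / 2, (1 : ℝ)) = toReal (x, 1) := by simp [toReal]
        rwa [e]
      refine ⟨min (a₀ + a₂) (2 * a₁), max (b₀ + b₂) (2 * b₁), ?_, ?_, min_le_left _ _,
        le_max_left _ _, fun v hv hv1 => ?_⟩
      · rcases min_choice (a₀ + a₂) (2 * a₁) with e | e <;> rw [e]
        exacts [half_sum_mem_hull ha₀ ha₂, key _ ha]
      · rcases max_choice (b₀ + b₂) (2 * b₁) with e | e <;> rw [e]
        exacts [half_sum_mem_hull hb₀ hb₂, key _ hb]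
      · have := h₁ v hv hv1
        omega
    · exact ⟨_, _, half_sum_mem_hull ha₀ ha₂, half_sum_mem_hull hb₀ hb₂, le_rfl, le_rfl,
        fun v hv hv1 => absurd ⟨v, hv, hv1⟩ h1⟩
  obtain ⟨P, Q, hP, hQ, hPle, hQle, h₁⟩ := hmid
  refine ⟨a₀, b₀, a₂, b₂, P, Q, ha₀, hb₀, ha₂, hb₂, hP, hQ, hPle, hQle, fun v hv => ?_⟩
  have := hy v hv
  obtain h | h | h : v.2 = 0 ∨ v.2 = 2 ∨ v.2 = 1 := by omega
  exacts [.inl ⟨h, h₀ v hv h⟩, .inr (.inl ⟨h, h₂ v hv h⟩), .inr (.inr ⟨h, h₁ v hv h⟩)]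

section StripData

variable {V : Set (ℤ × ℤ)} {a₀ b₀ a₂ b₂ P Q : ℤ} (D : StripData V a₀ b₀ a₂ b₂ P Q)

include D

theorem StripData.covered_cases {z : ℤ × ℤ} (hz : Covered V (toReal z)) :
    (z.2 = 0 ∧ a₀ ≤ z.1 ∧ z.1 ≤ b₀) ∨ (z.2 = 2 ∧ a₂ ≤ z.1 ∧ z.1 ≤ b₂) ∨
      (z.2 = 1 ∧ P ≤ 2 * z.1 ∧ 2 * z.1 ≤ Q) := by
  have key : ∀ p q r : ℤ, (∀ v ∈ V, p * v.1 + q * v.2 ≤ r) → p * z.1 + q * z.2 ≤ r := by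
    intro p q r hr
    obtain ⟨v, hv, hle⟩ := hz p q
    simp only [toReal] at hle
    have hle' : p * z.1 + q * z.2 ≤ p * v.1 + q * v.2 := by exact_mod_cast hle
    exact hle'.trans (hr v hv)
  have hP := D.le_P
  have hQ := D.Q_le
  have y0 := key 0 (-1) 0 fun v hv => by rcases D.cases v hv with h | h | h <;> omega
  have y2 := key 0 1 2 fun v hv => by rcases D.cases v hv with h | h | h <;> omega
  have r0 := key 2 (2 * b₀ - Q) (2 * b₀) fun v hv => by
    rcases D.cases v hv with ⟨e, h, h'⟩ | ⟨e, h, h'⟩ | ⟨e, h, h'⟩ <;> rw [e] <;> omega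
  have r2 := key 2 (Q - 2 * b₂) (2 * Q - 2 * b₂) fun v hv => by
    rcases D.cases v hv with ⟨e, h, h'⟩ | ⟨e, h, h'⟩ | ⟨e, h, h'⟩ <;> rw [e] <;> omega
  have s0 := key (-2) (P - 2 * a₀) (-2 * a₀) fun v hv => by
    rcases D.cases v hv with ⟨e, h, h'⟩ | ⟨e, h, h'⟩ | ⟨e, h, h'⟩ <;> rw [e] <;> omega
  have s2 := key (-2) (2 * a₂ - P) (2 * a₂ - 2 * P) fun v hv => by
    rcases D.cases v hv with ⟨e, h, h'⟩ | ⟨e, h, h'⟩ | ⟨e, h, h'⟩ <;> rw [e] <;> omega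
  obtain h | h | h : z.2 = 0 ∨ z.2 = 2 ∨ z.2 = 1 := by omega
  all_goals rw [h] at r0 r2 s0 s2; omega

theorem StripData.inside_of_lt {x : ℝ} (h₁ : (P : ℝ) / 2 < x) (h₂ : x < (Q : ℝ) / 2) :
    Inside V (x, 1) :=
  inside_of_chord D.mem_P D.mem_Q (toReal_mem_hull D.mem_a₀) (toReal_mem_hull D.mem_a₂) h₁ h₂
    (by simp [toReal]) (by simp [toReal])

theorem StripData.inner_cases {z : ℤ × ℤ} (hz : Inside V (toReal z)) :
    z.2 = 1 ∧ P < 2 * z.1 ∧ 2 * z.1 < Q := by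
  have key : ∀ p q r : ℤ, (p ≠ 0 ∨ q ≠ 0) → (∀ v ∈ V, p * v.1 + q * v.2 ≤ r) →
      p * z.1 + q * z.2 < r := by
    intro p q r hpq hr
    obtain ⟨v, hv, hlt⟩ := hz p q (by exact_mod_cast hpq)
    simp only [toReal] at hlt
    have hlt' : p * z.1 + q * z.2 < p * v.1 + q * v.2 := by exact_mod_cast hlt
    exact hlt'.trans_le (hr v hv)
  have hP := D.le_P
  have hQ := D.Q_le
  have y0 := key 0 (-1) 0 (by simp) fun v hv => by rcases D.cases v hv with h | h | h <;> omega
  have y2 := key 0 1 2 (by simp) fun v hv => by rcases D.cases v hv with h | h | h <;> omega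
  have r0 := key 2 (2 * b₀ - Q) (2 * b₀) (by simp) fun v hv => by
    rcases D.cases v hv with ⟨e, h, h'⟩ | ⟨e, h, h'⟩ | ⟨e, h, h'⟩ <;> rw [e] <;> omega
  have s0 := key (-2) (P - 2 * a₀) (-2 * a₀) (by simp) fun v hv => by
    rcases D.cases v hv with ⟨e, h, h'⟩ | ⟨e, h, h'⟩ | ⟨e, h, h'⟩ <;> rw [e] <;> omega
  have h : z.2 = 1 := by omega
  rw [h] at r0 s0
  omega

theorem StripData.le : a₀ ≤ b₀ ∧ a₂ ≤ b₂ := by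
  have h₀ := D.cases _ D.mem_a₀
  have h₂ := D.cases _ D.mem_a₂
  simp only at h₀ h₂
  omega

theorem StripData.inner_subset : innerPts V ⊆
    ((Finset.Ioo (P / 2) ((Q + 1) / 2)).image (fun n => (n, (1 : ℤ))) : Finset (ℤ × ℤ)) := by
  rintro ⟨x, y⟩ hz
  have := D.inner_cases hz
  simp only at this
  obtain ⟨rfl, h⟩ := this
  simp only [Finset.coe_image, Finset.coe_Ioo, mem_image, mem_Ioo]
  exact ⟨x, by omega, rfl⟩

theorem StripData.ncard_innerPts_le :
    (innerPts V).ncard ≤ (Finset.Ioo (P / 2) ((Q + 1) / 2)).card := by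
  have hi := Set.ncard_le_ncard D.inner_subset (Finset.finite_toSet _)
  rw [Set.ncard_coe_finset] at hi
  exact hi.trans Finset.card_image_le

theorem StripData.boundary_subset : boundaryPts V ⊆
    (((Finset.Icc a₀ b₀).image (fun n => (n, (0 : ℤ))) ∪
      (Finset.Icc a₂ b₂).image (fun n => (n, (2 : ℤ)))) ∪
    ((Finset.Icc ((P + 1) / 2) (P / 2)).image (fun n => (n, (1 : ℤ))) ∪
      (Finset.Icc ((Q + 1) / 2) (Q / 2)).image (fun n => (n, (1 : ℤ)))) : Finset (ℤ × ℤ)) := by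
  rintro ⟨x, y⟩ ⟨hc, hi⟩
  simp only [Finset.coe_union, Finset.coe_image, Finset.coe_Icc, mem_union, mem_image, mem_Icc,
    Prod.mk.injEq]
  rcases D.covered_cases hc with ⟨rfl, h⟩ | ⟨rfl, h⟩ | ⟨rfl, h⟩
  · exact .inl (.inl ⟨x, h, rfl, rfl⟩)
  · exact .inl (.inr ⟨x, h, rfl, rfl⟩)
  · have hx : ¬ (P < 2 * x ∧ 2 * x < Q) := by
      rintro ⟨h₁, h₂⟩
      have h₁' : (P : ℝ) < 2 * x := by exact_mod_cast h₁
      have h₂' : 2 * (x : ℝ) < Q := by exact_mod_cast h₂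
      have := D.inside_of_lt (x := x) (by linarith) (by linarith)
      exact hi (by simpa [toReal] using this)
    simp only at h
    by_cases hPx : P = 2 * x
    · exact .inr (.inl ⟨x, by omega, rfl, rfl⟩)
    · exact .inr (.inr ⟨x, by omega, rfl, rfl⟩)

theorem StripData.two_mul_ncard_add_ncard_le (hPQ : P < Q) :
    (2 * (innerPts V).ncard + (boundaryPts V).ncard : ℤ) ≤
      (Q - P) + (b₀ - a₀) + (b₂ - a₂) + 2 := by
  have hi := D.ncard_innerPts_le
  have hb := Set.ncard_le_ncard D.boundary_subset (Finset.finite_toSet _)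
  rw [Set.ncard_coe_finset] at hb
  replace hb := hb.trans ((Finset.card_union_le _ _).trans (add_le_add
    ((Finset.card_union_le _ _).trans (add_le_add Finset.card_image_le Finset.card_image_le))
    ((Finset.card_union_le _ _).trans (add_le_add Finset.card_image_le Finset.card_image_le))))
  simp only [Int.card_Icc, Int.card_Ioo] at hi hb
  have := D.le
  omega

end StripData

/-- The chord bounds of the two sections meeting the planes at integral height. -/
theorem StripData.chord_bounds {V : Set (ℤ × ℤ)} {a₀ b₀ a₂ b₂ P Q : ℤ}
    (D : StripData V a₀ b₀ a₂ b₂ P Q) {h : ℤ} {α : ℤ × ℤ} (hfree : Free V h α) (hh : 4 ≤ h)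
    {β : ℤ} (hα : α.2 = 1 + β) (hβ0 : 0 ≤ β) (hβ : 2 * β ≤ h) :
    2 * β * (b₀ - a₀) + (h - 1 - β) * (Q - P) ≤ 2 * h ∧
      (2 ≤ β → 2 * (h - β) * (b₂ - a₂) + (β - 1) * (Q - P) ≤ 2 * h) := by
  have hh' : (4 : ℝ) ≤ h := by exact_mod_cast hh
  have hβ0' : (0 : ℝ) ≤ β := by exact_mod_cast hβ0
  have hβ' : (2 : ℝ) * β ≤ h := by exact_mod_cast hβ
  have hα' : (α.2 : ℝ) = 1 + β := by exact_mod_cast hα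
  have hpos : (0 : ℝ) < h - 1 := by linarith
  have ha₀ := toReal_mem_hull D.mem_a₀
  have ha₂ := toReal_mem_hull D.mem_a₂
  have hb₀ := toReal_mem_hull D.mem_b₀
  have hb₂ := toReal_mem_hull D.mem_b₂
  constructor
  · set t : ℝ := β / (h - 1) with ht
    have ht' : t * (h - 1) = β := by rw [ht]; field_simp
    have ht0 : 0 ≤ t := by rw [ht]; positivity
    have ht1 : t < 1 := by rw [ht, div_lt_one hpos]; linarith
    have e1 := combo_mem_hull D.mem_P ha₀ ht0 ht1.le
    have e2 := combo_mem_hull D.mem_Q hb₀ ht0 ht1.le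
    simp only [toReal, Int.cast_zero, mul_zero, add_zero, mul_one] at e1 e2
    have := hfree.chord_le hh 1 (by rw [hα']; push_cast; linarith) e1 e2 ha₀ ha₂
      (by simp only [toReal, Int.cast_zero]; linarith)
      (by simp only [toReal, Int.cast_ofNat]; linarith)
    have key : (2 * β * (b₀ - a₀) + (h - 1 - β) * (Q - P) : ℝ) ≤ 2 * h := by
      rw [← ht']; nlinarith
    exact_mod_cast key
  · intro hβ2
    have hβ2' : (2 : ℝ) ≤ β := by exact_mod_cast hβ2
    set t : ℝ := (h - β) / (h - 1) with ht
    have ht' : t * (h - 1) = h - β := by rw [ht]; field_simp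
    have ht0 : 0 ≤ t := by rw [ht]; apply div_nonneg <;> linarith
    have ht1 : t < 1 := by rw [ht, div_lt_one hpos]; linarith
    have e1 := combo_mem_hull D.mem_P ha₂ ht0 ht1.le
    have e2 := combo_mem_hull D.mem_Q hb₂ ht0 ht1.le
    simp only [toReal, Int.cast_ofNat, mul_one] at e1 e2
    have := hfree.chord_le hh 2 (by rw [hα']; push_cast; linarith) e1 e2 ha₀ ha₂
      (by simp only [toReal, Int.cast_zero]; linarith)
      (by simp only [toReal, Int.cast_ofNat]; linarith)
    have key : (2 * (h - β) * (b₂ - a₂) + (β - 1) * (Q - P) : ℝ) ≤ 2 * h := by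
      have e : (β : ℝ) - 1 = (1 - t) * (h - 1) := by linarith
      rw [← ht', e]; nlinarith
    exact_mod_cast key

theorem strip_length_bound {h β L l₀ l₂ : ℤ} (hh : 4 ≤ h) (hβ0 : 0 ≤ β) (hβ : 2 * β ≤ h)
    (h₀ : 0 ≤ l₀) (h₂ : 0 ≤ l₂) (hL : l₀ + l₂ ≤ L)
    (c₁ : 2 * β * l₀ + (h - 1 - β) * L ≤ 2 * h)
    (c₂ : 2 ≤ β → 2 * (h - β) * l₂ + (β - 1) * L ≤ 2 * h) :
    (L + l₀ + l₂) * (h - 2) ≤ 4 * h := by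
  obtain rfl | rfl | hβ2 : β = 0 ∨ β = 1 ∨ 2 ≤ β := by omega
  · nlinarith
  · nlinarith
  · have c₂ := c₂ hβ2
    rcases le_total l₂ l₀ with hle | hle
    · nlinarith [mul_le_mul_of_nonneg_left hle (by omega : 0 ≤ β - 1),
        mul_le_mul_of_nonneg_left hL (by omega : 0 ≤ h - 2 * β)]
    · nlinarith [mul_le_mul_of_nonneg_left hle (by omega : 0 ≤ h - 2 * β)]

theorem StripData.count_bounds {V : Set (ℤ × ℤ)} {a₀ b₀ a₂ b₂ P Q : ℤ}
    (D : StripData V a₀ b₀ a₂ b₂ P Q) {h : ℤ} {α : ℤ × ℤ} (hfree : Free V h α) (hh : 4 ≤ h)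
    {β : ℤ} (hα : α.2 = 1 + β) (hβ0 : 0 ≤ β) (hβ : 2 * β ≤ h) (hne : (innerPts V).Nonempty) :
    (2 * (innerPts V).ncard + (boundaryPts V).ncard : ℤ) * (h - 2) ≤ 6 * h - 4 ∧
      (3 ≤ (boundaryPts V).ncard → (innerPts V).ncard ≤ 2) := by
  obtain ⟨z, hz⟩ := hne
  have hPQ := D.inner_cases hz
  have hcount := D.two_mul_ncard_add_ncard_le (by omega)
  obtain ⟨c₁, c₂⟩ := D.chord_bounds hfree hh hα hβ0 hβ
  have hle := D.le
  have hPle := D.le_P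
  have hQle := D.Q_le
  have hlen := strip_length_bound (L := Q - P) hh hβ0 hβ (by omega : 0 ≤ b₀ - a₀)
    (by omega : 0 ≤ b₂ - a₂) (by omega) c₁ c₂
  have hmain : (2 * (innerPts V).ncard + (boundaryPts V).ncard : ℤ) * (h - 2) ≤ 6 * h - 4 := by
    nlinarith
  refine ⟨hmain, fun hb => ?_⟩
  by_contra! hi
  have hi' := hi.trans_le D.ncard_innerPts_le
  rw [Int.card_Ioo] at hi'
  obtain rfl : h = 4 := by
    have : (9 : ℤ) * (h - 2) ≤ 6 * h - 4 := by
      refine le_trans (mul_le_mul_of_nonneg_right ?_ (by omega)) hmain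
      omega
    omega
  obtain rfl | rfl | rfl : β = 0 ∨ β = 1 ∨ β = 2 := by omega
  · omega
  · omega
  · obtain ⟨m, hm⟩ : ∃ m : ℤ, P < 2 * (2 * m - α.1) ∧ 2 * (2 * m - α.1) < Q :=
      ⟨(P / 2 + 2 + α.1) / 2, by omega, by omega⟩
    have h₁ : (P : ℝ) < 2 * (2 * m - α.1) := by exact_mod_cast hm.1
    have h₂ : 2 * (2 * m - α.1) < (Q : ℝ) := by exact_mod_cast hm.2
    refine hfree 2 (.inr rfl) m 2 ?_
    have := D.inside_of_lt (x := 2 * m - α.1) (by linarith) (by linarith)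
    rw [hα]
    convert this using 2
    · push_cast; ring
    · norm_num


section Transport

variable {a b c d e f ε : ℤ} (hε : a * d - b * c = ε) (hε2 : ε * ε = 1) (V : Set (ℤ × ℤ))

include hε hε2

theorem innerPts_affine_image :
    innerPts (affine a b c d e f '' V) = affine a b c d e f '' innerPts V := by
  ext w
  obtain ⟨z, rfl⟩ := (affine_bijective (e := e) (f := f) hε hε2).2 w
  rw [(affine_bijective hε hε2).1.mem_set_image, innerPts, innerPts, mem_ofPred_eq, mem_ofPred_eq,
    ← affineReal_toReal, inside_affine_iff hε hε2]

theorem boundaryPts_affine_image :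
    boundaryPts (affine a b c d e f '' V) = affine a b c d e f '' boundaryPts V := by
  ext w
  obtain ⟨z, rfl⟩ := (affine_bijective (e := e) (f := f) hε hε2).2 w
  rw [(affine_bijective hε hε2).1.mem_set_image, boundaryPts, boundaryPts, mem_ofPred_eq,
    mem_ofPred_eq, ← affineReal_toReal, inside_affine_iff hε hε2, covered_affine_iff hε hε2]

theorem ncard_innerPts_affine_image :
    (innerPts (affine a b c d e f '' V)).ncard = (innerPts V).ncard := by
  rw [innerPts_affine_image hε hε2, Set.ncard_image_of_injective _ (affine_bijective hε hε2).1]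

theorem ncard_boundaryPts_affine_image :
    (boundaryPts (affine a b c d e f '' V)).ncard = (boundaryPts V).ncard := by
  rw [boundaryPts_affine_image hε hε2, Set.ncard_image_of_injective _ (affine_bijective hε hε2).1]

end Transport

theorem Free.shift {V : Set (ℤ × ℤ)} {h : ℤ} {α : ℤ × ℤ} (hfree : Free V h α) (s : ℤ) :
    Free V h (α.1, α.2 + h * s) := by
  intro k hk m n H
  refine hfree k hk m (n - k * s) ?_
  convert H using 3
  push_cast
  ring

theorem Free.count_bounds_of_strip {V : Set (ℤ × ℤ)} {h : ℤ} {α : ℤ × ℤ} (hfree : Free V h α)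
    (hfin : V.Finite) (hh : 4 ≤ h) (hy : ∀ v ∈ V, 0 ≤ v.2 ∧ v.2 ≤ 2) (h0 : ∃ v ∈ V, v.2 = 0)
    (h2 : ∃ v ∈ V, v.2 = 2) (hne : (innerPts V).Nonempty) :
    (2 * (innerPts V).ncard + (boundaryPts V).ncard : ℤ) * (h - 2) ≤ 6 * h - 4 ∧
      (3 ≤ (boundaryPts V).ncard → (innerPts V).ncard ≤ 2) := by
  have hmod0 := Int.emod_nonneg (α.2 - 1) (by omega : h ≠ 0)
  have hmod1 := Int.emod_lt_of_pos (α.2 - 1) (by omega : 0 < h)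
  have hmod2 := Int.emod_add_mul_ediv (α.2 - 1) h
  set γ := (α.2 - 1) % h with hγ
  rcases le_total (2 * γ) h with hle | hle
  · obtain ⟨a₀, b₀, a₂, b₂, P, Q, D⟩ := exists_stripData hfin hy h0 h2
    refine D.count_bounds (hfree.shift (-((α.2 - 1) / h))) hh (β := γ) ?_ hmod0 hle hne
    simp only
    linarith
  · have hdet : (1 : ℤ) * (-1) - 0 * 0 = -1 := by norm_num
    have h1 : (-1 : ℤ) * (-1) = 1 := by norm_num
    rw [← ncard_innerPts_affine_image (e := 0) (f := 2) hdet h1 V,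
      ← ncard_boundaryPts_affine_image (e := 0) (f := 2) hdet h1 V]
    obtain ⟨a₀, b₀, a₂, b₂, P, Q, D⟩ :=
      exists_stripData (V := affine 1 0 0 (-1) 0 2 '' V) (hfin.image _)
        (by
          rintro _ ⟨v, hv, rfl⟩
          have := hy v hv
          simp only [LatticePolygon.affine]
          omega)
        (by
          obtain ⟨v, hv, hv2⟩ := h2
          exact ⟨_, mem_image_of_mem _ hv, by simp [LatticePolygon.affine, hv2]⟩)
        (by
          obtain ⟨v, hv, hv0⟩ := h0
          exact ⟨_, mem_image_of_mem _ hv, by simp [LatticePolygon.affine, hv0]⟩)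
    refine D.count_bounds ((hfree.affine_image hdet h1 hh).shift ((α.2 - 1) / h + 1)) hh
      (β := h - γ) ?_ (by omega) (by omega) ?_
    · simp only [LatticePolygon.affine]
      linarith
    · rw [innerPts_affine_image hdet h1]
      exact hne.image _

theorem Free.count_bounds {V : Set (ℤ × ℤ)} {h : ℤ} {α : ℤ × ℤ} (hfree : Free V h α)
    (hfin : V.Finite) (hh : 4 ≤ h) (hne : (innerPts V).Nonempty) :
    (2 * (innerPts V).ncard + (boundaryPts V).ncard : ℤ) * (h - 2) ≤ 6 * h - 4 ∧
      (3 ≤ (boundaryPts V).ncard → (innerPts V).ncard ≤ 2) := by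
  obtain ⟨z, hz⟩ := hne
  have hW := widthGe_two_of_inside hz
  obtain ⟨a, b, c, d, hdet, hcd⟩ := exists_primitive_of_width (by norm_num) hW
    (hfree.not_widthGe_three hfin hh)
  have h1 : (1 : ℤ) * 1 = 1 := by norm_num
  obtain ⟨v, hv, w, hw, hvw⟩ := hW c d (by
    by_contra! hcon
    rw [hcon.1, hcon.2] at hdet
    omega)
  obtain ⟨t, ht⟩ : ∃ t : ℤ, t = c * w.1 + d * w.2 := ⟨_, rfl⟩
  rw [← ncard_innerPts_affine_image (e := 0) (f := -t) hdet h1 V,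
    ← ncard_boundaryPts_affine_image (e := 0) (f := -t) hdet h1 V]
  refine (hfree.affine_image hdet h1 hh).count_bounds_of_strip (hfin.image _) hh ?_ ?_ ?_ ?_
  · rintro _ ⟨u, hu, rfl⟩
    have k1 := hcd u hu w hw
    have k2 := hcd v hv u hu
    simp only [LatticePolygon.affine]
    constructor <;> linarith
  · exact ⟨_, mem_image_of_mem _ hw, by simp only [LatticePolygon.affine]; linarith⟩
  · have k1 := hcd v hv w hw
    exact ⟨_, mem_image_of_mem _ hv, by simp only [LatticePolygon.affine]; linarith⟩
  · rw [innerPts_affine_image hdet h1]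
    exact ⟨_, mem_image_of_mem _ hz⟩


theorem finite_covered {V : Set (ℤ × ℤ)} (hfin : V.Finite) :
    {z : ℤ × ℤ | Covered V (toReal z)}.Finite := by
  obtain ⟨B₁, hB₁⟩ := (hfin.image Prod.fst).bddAbove
  obtain ⟨B₂, hB₂⟩ := (hfin.image Prod.snd).bddAbove
  obtain ⟨C₁, hC₁⟩ := (hfin.image Prod.fst).bddBelow
  obtain ⟨C₂, hC₂⟩ := (hfin.image Prod.snd).bddBelow
  refine (Set.finite_Icc (C₁, C₂) (B₁, B₂)).subset fun z hz => ?_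
  have key : ∀ p q r : ℤ, (∀ v ∈ V, p * v.1 + q * v.2 ≤ r) → p * z.1 + q * z.2 ≤ r := by
    intro p q r hr
    obtain ⟨v, hv, hle⟩ := hz p q
    simp only [toReal] at hle
    have hle' : p * z.1 + q * z.2 ≤ p * v.1 + q * v.2 := by exact_mod_cast hle
    exact hle'.trans (hr v hv)
  have h₁ := key 1 0 B₁ fun v hv => by have := hB₁ (mem_image_of_mem _ hv); omega
  have h₂ := key 0 1 B₂ fun v hv => by have := hB₂ (mem_image_of_mem _ hv); omega
  have h₃ := key (-1) 0 (-C₁) fun v hv => by have := hC₁ (mem_image_of_mem _ hv); omega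
  have h₄ := key 0 (-1) (-C₂) fun v hv => by have := hC₂ (mem_image_of_mem _ hv); omega
  exact ⟨⟨by simp only; omega, by simp only; omega⟩, ⟨by simp only; omega, by simp only; omega⟩⟩

/-- The vector underlying an integer point of the plane. -/
def toVec (v : ℤ × ℤ) : Fin 2 → ℝ := ![(v.1 : ℝ), (v.2 : ℝ)]

/-- The convex hull of a set of integer points, as a set of vectors. -/
def polygon (V : Set (ℤ × ℤ)) : Set (Fin 2 → ℝ) := convexHull ℝ (toVec '' V)

theorem toVec_injective : Function.Injective toVec := by
  intro v w hvw
  have h0 := congrFun hvw 0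
  have h1 := congrFun hvw 1
  simp only [toVec, Matrix.cons_val_zero, Matrix.cons_val_one, Int.cast_inj] at h0 h1
  exact Prod.ext h0 h1

theorem dual_apply (f : StrongDual ℝ (Fin 2 → ℝ)) (x : Fin 2 → ℝ) :
    f x = f ![1, 0] * x 0 + f ![0, 1] * x 1 := by
  have : x = x 0 • ![1, 0] + x 1 • ![0, 1] := by
    ext i
    fin_cases i <;> simp
  conv_lhs => rw [this]
  simp only [map_add, map_smul, smul_eq_mul]
  ring

theorem polygon_le {V : Set (ℤ × ℤ)} {p q r : ℝ} (hV : ∀ v ∈ V, p * (v.1 : ℝ) + q * v.2 ≤ r)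
    {x : Fin 2 → ℝ} (hx : x ∈ polygon V) : p * x 0 + q * x 1 ≤ r := by
  have hc : Convex ℝ {y : Fin 2 → ℝ | p * y 0 + q * y 1 ≤ r} := by
    intro y hy z hz a b ha hb hab
    simp only [mem_ofPred_eq, Pi.add_apply, Pi.smul_apply, smul_eq_mul] at *
    have hr : r = a * r + b * r := by rw [← add_mul, hab, one_mul]
    nlinarith [mul_le_mul_of_nonneg_left hy ha, mul_le_mul_of_nonneg_left hz hb]
  exact convexHull_min (by rintro _ ⟨v, hv, rfl⟩; exact hV v hv) hc hx

theorem convex_polygon (V : Set (ℤ × ℤ)) : Convex ℝ (polygon V) := convex_convexHull ℝ _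

section Polygon

variable {V : Set (ℤ × ℤ)} (hfin : V.Finite)

include hfin

theorem isClosed_polygon : IsClosed (polygon V) := (hfin.image _).isClosed_convexHull ℝ

theorem mem_polygon_iff {x : Fin 2 → ℝ} : x ∈ polygon V ↔ Covered V (x 0, x 1) := by
  constructor
  · intro hx p q
    obtain rfl | hne := V.eq_empty_or_nonempty
    · simp [polygon] at hx
    obtain ⟨v, hv, hmax⟩ := exists_max_image V (fun v => p * (v.1 : ℝ) + q * v.2) hfin hne
    exact ⟨v, hv, polygon_le hmax hx⟩
  · intro hx
    by_contra hcon
    obtain ⟨f, u, hf, hu⟩ :=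
      geometric_hahn_banach_closed_point (convex_polygon V) (isClosed_polygon hfin) hcon
    obtain ⟨v, hv, hle⟩ := hx (f ![1, 0]) (f ![0, 1])
    have h₁ := hf _ (subset_convexHull ℝ _ (mem_image_of_mem toVec hv))
    rw [dual_apply] at h₁ hu
    simp only [toVec, Matrix.cons_val_zero, Matrix.cons_val_one] at h₁
    linarith

theorem mem_interior_polygon_iff (hne : (interior (polygon V)).Nonempty) {x : Fin 2 → ℝ} :
    x ∈ interior (polygon V) ↔ Inside V (x 0, x 1) := by
  constructor
  · intro hx p q hpq
    have hcont : ContinuousAt (fun t : ℝ => x + t • ![p, q]) 0 := by fun_prop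
    have hev : ∀ᶠ t in nhds (0 : ℝ), x + t • ![p, q] ∈ polygon V :=
      hcont.eventually (by simpa using mem_interior_iff_mem_nhds.1 hx)
    obtain ⟨t, ht, ht0⟩ :=
      ((hev.filter_mono nhdsWithin_le_nhds).and (self_mem_nhdsWithin (s := Ioi 0))).exists
    obtain ⟨v, hv, hle⟩ := (mem_polygon_iff hfin).1 ht p q
    refine ⟨v, hv, lt_of_lt_of_le ?_ hle⟩
    have hpos : 0 < t * (p * p + q * q) := by
      refine mul_pos ht0 ?_
      rcases hpq with h | h
      · nlinarith [mul_self_pos.2 h, mul_self_nonneg q]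
      · nlinarith [mul_self_pos.2 h, mul_self_nonneg p]
    simp only [Pi.add_apply, Pi.smul_apply, smul_eq_mul, Matrix.cons_val_zero, Matrix.cons_val_one]
    linarith
  · intro hx
    by_contra hcon
    have hconv := convex_polygon V
    obtain ⟨f, hf⟩ := geometric_hahn_banach_point_open hconv.interior isOpen_interior hcon
    have hle : ∀ y ∈ polygon V, f x ≤ f y := by
      intro y hy
      have hy' : y ∈ closure (interior (polygon V)) := by
        rw [hconv.closure_interior_eq_closure_of_nonempty_interior hne]
        exact subset_closure hy
      exact closure_minimal (fun b hb => (hf b hb).le)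
        (isClosed_le continuous_const f.continuous) hy'
    obtain ⟨b, hb⟩ := hne
    have hb' := hf b hb
    obtain ⟨v, hv, hlt⟩ := hx (-f ![1, 0]) (-f ![0, 1]) (by
      by_contra! h0
      simp only [neg_eq_zero] at h0
      rw [dual_apply, dual_apply f b, h0.1, h0.2] at hb'
      simp at hb')
    have h₁ := hle _ (subset_convexHull ℝ _ (mem_image_of_mem toVec hv))
    rw [dual_apply, dual_apply f (toVec v)] at h₁
    simp only [toVec, Matrix.cons_val_zero, Matrix.cons_val_one] at h₁
    linarith

end Polygon

theorem intrinsicInterior_eq_interior {s : Set (Fin 2 → ℝ)} (hs : Convex ℝ s)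
    (hne : (interior s).Nonempty) : intrinsicInterior ℝ s = interior s := by
  refine Subset.antisymm ?_ interior_subset_intrinsicInterior
  have htop := hs.interior_nonempty_iff_affineSpan_eq_top.1 hne
  have hopen : IsOpen (affineSpan ℝ s : Set (Fin 2 → ℝ)) := by rw [htop]; exact isOpen_univ
  refine interior_maximal intrinsicInterior_subset ?_
  exact hopen.isOpenMap_subtype_val _ isOpen_interior

theorem intrinsicFrontier_eq_sdiff_interior {s : Set (Fin 2 → ℝ)} (hs : Convex ℝ s)
    (hcl : IsClosed s) (hne : (interior s).Nonempty) :
    intrinsicFrontier ℝ s = s \ interior s := by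
  rw [← intrinsicClosure_sdiff_intrinsicInterior, intrinsicInterior_eq_interior hs hne,
    (hcl.preimage continuous_subtype_val).intrinsicClosure]


theorem intrinsicInterior_polygon_inter {V : Set (ℤ × ℤ)} (hfin : V.Finite)
    (hne : (interior (polygon V)).Nonempty) :
    intrinsicInterior ℝ (polygon V) ∩ intPts 2 = toVec '' innerPts V := by
  rw [intrinsicInterior_eq_interior (convex_polygon V) hne]
  ext x
  constructor
  · rintro ⟨hx, hint⟩
    obtain ⟨m, hm⟩ := hint 0
    obtain ⟨n, hn⟩ := hint 1
    rw [mem_interior_polygon_iff hfin hne, hm, hn] at hx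
    refine ⟨(m, n), hx, ?_⟩
    ext i
    fin_cases i <;> simp [toVec, hm, hn]
  · rintro ⟨z, hz, rfl⟩
    refine ⟨(mem_interior_polygon_iff hfin hne).2 hz, fun i => ?_⟩
    fin_cases i
    exacts [⟨z.1, rfl⟩, ⟨z.2, rfl⟩]

theorem intrinsicFrontier_polygon_inter {V : Set (ℤ × ℤ)} (hfin : V.Finite)
    (hne : (interior (polygon V)).Nonempty) :
    intrinsicFrontier ℝ (polygon V) ∩ intPts 2 = toVec '' boundaryPts V := by
  rw [intrinsicFrontier_eq_sdiff_interior (convex_polygon V) (isClosed_polygon hfin) hne]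
  ext x
  constructor
  · rintro ⟨⟨hx, hx'⟩, hint⟩
    obtain ⟨m, hm⟩ := hint 0
    obtain ⟨n, hn⟩ := hint 1
    rw [mem_interior_polygon_iff hfin hne, hm, hn] at hx'
    rw [mem_polygon_iff hfin, hm, hn] at hx
    refine ⟨(m, n), ⟨hx, hx'⟩, ?_⟩
    ext i
    fin_cases i <;> simp [toVec, hm, hn]
  · rintro ⟨z, ⟨hz, hz'⟩, rfl⟩
    refine ⟨⟨(mem_polygon_iff hfin).2 hz, fun h => hz' ?_⟩, fun i => ?_⟩
    · exact (mem_interior_polygon_iff hfin hne).1 h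
    · fin_cases i
      exacts [⟨z.1, rfl⟩, ⟨z.2, rfl⟩]

theorem two_le_widthAlong_polygon {V : Set (ℤ × ℤ)} (hfin : V.Finite) (hW : WidthGe V 2)
    {u : Fin 2 → ℤ} (hu : u ≠ 0) : 2 ≤ widthAlong (polygon V) u := by
  have hu' : u 0 ≠ 0 ∨ u 1 ≠ 0 := by
    by_contra! hcon
    exact hu (by ext i; fin_cases i; exacts [hcon.1, hcon.2])
  obtain ⟨v, hv, w, hw, hvw⟩ := hW _ _ hu'
  have hmem : ∀ v ∈ V, (u 0 : ℝ) * v.1 + u 1 * v.2 ∈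
      (fun x : Fin 2 → ℝ => ∑ i, (u i : ℝ) * x i) '' polygon V := fun v hv =>
    ⟨toVec v, subset_convexHull ℝ _ (mem_image_of_mem _ hv), by simp [toVec]⟩
  have hne : V.Nonempty := ⟨v, hv⟩
  obtain ⟨s, -, hs⟩ := exists_max_image V (fun v => (u 0 : ℝ) * v.1 + u 1 * v.2) hfin hne
  obtain ⟨t, -, ht⟩ := exists_max_image V (fun v => (-u 0 : ℝ) * v.1 + -u 1 * v.2) hfin hne
  have habove : BddAbove ((fun x : Fin 2 → ℝ => ∑ i, (u i : ℝ) * x i) '' polygon V) := by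
    refine ⟨(u 0 : ℝ) * s.1 + u 1 * s.2, ?_⟩
    rintro _ ⟨x, hx, rfl⟩
    simpa using polygon_le hs hx
  have hbelow : BddBelow ((fun x : Fin 2 → ℝ => ∑ i, (u i : ℝ) * x i) '' polygon V) := by
    refine ⟨-((-u 0 : ℝ) * t.1 + -u 1 * t.2), ?_⟩
    rintro _ ⟨x, hx, rfl⟩
    have := polygon_le ht hx
    simp only [Fin.sum_univ_two]
    linarith
  have h₁ := le_csSup habove (hmem v hv)
  have h₂ := csInf_le hbelow (hmem w hw)
  have h₃ : (2 : ℝ) ≤ u 0 * (v.1 - w.1) + u 1 * (v.2 - w.2) := by exact_mod_cast hvw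
  rw [widthAlong]
  linarith

theorem exists_widthAlong_polygon_le_two {V : Set (ℤ × ℤ)} (hfin : V.Finite) (hne : V.Nonempty)
    (hW : ¬ WidthGe V 3) : ∃ u : Fin 2 → ℤ, u ≠ 0 ∧ widthAlong (polygon V) u ≤ 2 := by
  simp only [WidthGe, not_forall] at hW
  obtain ⟨p, q, hpq, hle⟩ := hW
  push Not at hle
  refine ⟨![p, q], fun h0 => ?_, ?_⟩
  · have h₁ := congrFun h0 0
    have h₂ := congrFun h0 1
    simp only [Matrix.cons_val_zero, Matrix.cons_val_one, Pi.zero_apply] at h₁ h₂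
    exact hpq.elim (fun h => h h₁) (fun h => h h₂)
  · obtain ⟨s, hsV, hs⟩ := exists_max_image V (fun v => (p : ℝ) * v.1 + q * v.2) hfin hne
    obtain ⟨t, htV, ht⟩ := exists_max_image V (fun v => (-p : ℝ) * v.1 + -q * v.2) hfin hne
    have hnon : ((fun x : Fin 2 → ℝ => ∑ i, ((![p, q] i : ℤ) : ℝ) * x i) '' polygon V).Nonempty :=
      ((hne.image _).convexHull).image _
    have h₁ : sSup ((fun x : Fin 2 → ℝ => ∑ i, ((![p, q] i : ℤ) : ℝ) * x i) '' polygon V) ≤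
        p * s.1 + q * s.2 := by
      refine csSup_le hnon ?_
      rintro _ ⟨x, hx, rfl⟩
      simpa using polygon_le hs hx
    have h₂ : p * t.1 + q * t.2 ≤
        sInf ((fun x : Fin 2 → ℝ => ∑ i, ((![p, q] i : ℤ) : ℝ) * x i) '' polygon V) := by
      refine le_csInf hnon ?_
      rintro _ ⟨x, hx, rfl⟩
      have := polygon_le ht hx
      simp only [Fin.sum_univ_two, Matrix.cons_val_zero, Matrix.cons_val_one]
      linarith
    have h₃ : p * (s.1 - t.1) + q * (s.2 - t.2) ≤ 2 := by have := hle s hsV t htV; omega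
    have h₄ : (p : ℝ) * (s.1 - t.1) + q * (s.2 - t.2) ≤ 2 := by exact_mod_cast h₃
    rw [widthAlong]
    linarith


theorem mem_pyramid_iff {F : Set (Fin 3 → ℝ)} {a : Fin 3 → ℝ} (hF : Convex ℝ F)
    (hne : F.Nonempty) {x : Fin 3 → ℝ} :
    x ∈ convexHull ℝ (F ∪ {a}) ↔ ∃ y ∈ F, ∃ t : ℝ, 0 ≤ t ∧ t ≤ 1 ∧ x = (1 - t) • y + t • a := by
  rw [union_singleton, convexHull_insert hne, hF.convexHull_eq, mem_convexJoin]
  constructor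
  · rintro ⟨_, rfl, y, hy, hx⟩
    rw [segment_symm, segment_eq_image] at hx
    obtain ⟨t, ⟨h₀, h₁⟩, rfl⟩ := hx
    exact ⟨y, hy, t, h₀, h₁, rfl⟩
  · rintro ⟨y, hy, t, h₀, h₁, rfl⟩
    refine ⟨a, rfl, y, hy, ?_⟩
    rw [segment_symm, segment_eq_image]
    exact ⟨t, ⟨h₀, h₁⟩, rfl⟩

section Pyramid

variable {F : Set (Fin 3 → ℝ)} {a : Fin 3 → ℝ} {H : ℝ} (hF : Convex ℝ F) (hne : F.Nonempty)
  (hplane : F ⊆ {x | x 2 = 0}) (ha : a 2 = H) (hH : 0 < H)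

include hF hne hplane ha hH

theorem height_mem_of_mem_pyramid {x : Fin 3 → ℝ} (hx : x ∈ convexHull ℝ (F ∪ {a})) :
    0 ≤ x 2 ∧ x 2 ≤ H := by
  obtain ⟨y, hy, t, h₀, h₁, rfl⟩ := (mem_pyramid_iff hF hne).1 hx
  have hy2 : y 2 = 0 := hplane hy
  simp only [Pi.add_apply, Pi.smul_apply, smul_eq_mul, hy2, ha]
  constructor <;> nlinarith

theorem mem_base_of_mem_pyramid {x : Fin 3 → ℝ} (hx : x ∈ convexHull ℝ (F ∪ {a}))
    (hx2 : x 2 = 0) : x ∈ F := by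
  obtain ⟨y, hy, t, h₀, h₁, rfl⟩ := (mem_pyramid_iff hF hne).1 hx
  have hy2 : y 2 = 0 := hplane hy
  simp only [Pi.add_apply, Pi.smul_apply, smul_eq_mul, hy2, ha, mul_zero, zero_add, mul_eq_zero,
    hH.ne', or_false] at hx2
  simpa [hx2] using hy

theorem eq_apex_of_mem_pyramid {x : Fin 3 → ℝ} (hx : x ∈ convexHull ℝ (F ∪ {a}))
    (hx2 : x 2 = H) : x = a := by
  obtain ⟨y, hy, t, h₀, h₁, rfl⟩ := (mem_pyramid_iff hF hne).1 hx
  have hy2 : y 2 = 0 := hplane hy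
  simp only [Pi.add_apply, Pi.smul_apply, smul_eq_mul, hy2, ha, mul_zero, zero_add] at hx2
  have ht : t = 1 := by nlinarith
  simp [ht]

theorem mem_pyramid_of_section_mem {x : Fin 3 → ℝ} (hx0 : 0 ≤ x 2) (hx1 : x 2 < H)
    (hx : ![(H * x 0 - x 2 * a 0) / (H - x 2), (H * x 1 - x 2 * a 1) / (H - x 2)] ∈ proj2 '' F) :
    x ∈ convexHull ℝ (F ∪ {a}) := by
  obtain ⟨y, hy, hyx⟩ := hx
  have hy2 : y 2 = 0 := hplane hy
  have e0 := congrFun hyx 0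
  have e1 := congrFun hyx 1
  simp only [proj2, Matrix.cons_val_zero, Matrix.cons_val_one] at e0 e1
  have hpos : H - x 2 ≠ 0 := by linarith
  refine (mem_pyramid_iff hF hne).2 ⟨y, hy, x 2 / H, by positivity,
    (div_le_one hH).2 hx1.le, ?_⟩
  ext i
  fin_cases i
  · simp only [Fin.zero_eta, Pi.add_apply, Pi.smul_apply, smul_eq_mul, e0]
    field_simp
    ring
  · simp only [Fin.mk_one, Pi.add_apply, Pi.smul_apply, smul_eq_mul, e1]
    field_simp
    ring
  · simp only [Fin.reduceFinMk, Pi.add_apply, Pi.smul_apply, smul_eq_mul, hy2, ha]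
    field_simp
    ring

theorem mem_interior_pyramid_of_section {x : Fin 3 → ℝ} (hx0 : 0 < x 2) (hx1 : x 2 < H)
    (hx : ![(H * x 0 - x 2 * a 0) / (H - x 2), (H * x 1 - x 2 * a 1) / (H - x 2)] ∈
      interior (proj2 '' F)) :
    x ∈ interior (convexHull ℝ (F ∪ {a})) := by
  rw [mem_interior_iff_mem_nhds] at hx ⊢
  have hpos : H - x 2 ≠ 0 := by linarith
  have h2 : ContinuousAt (fun y : Fin 3 → ℝ => y 2) x := continuousAt_apply 2 x
  have hc : ContinuousAt (fun y : Fin 3 → ℝ =>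
      ![(H * y 0 - y 2 * a 0) / (H - y 2), (H * y 1 - y 2 * a 1) / (H - y 2)]) x := by
    refine continuousAt_pi.2 fun i => ?_
    fin_cases i
    · exact (((continuousAt_apply 0 x).const_mul H).sub (h2.mul_const _)).div
        (continuousAt_const.sub h2) hpos
    · exact (((continuousAt_apply 1 x).const_mul H).sub (h2.mul_const _)).div
        (continuousAt_const.sub h2) hpos
  filter_upwards [hc.eventually hx, h2.eventually (lt_mem_nhds hx0), h2.eventually (gt_mem_nhds hx1)]
    with y hy hy0 hy1
  exact mem_pyramid_of_section_mem hF hne hplane ha hH hy0.le hy1 hy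

/-- If the pyramid is inclusion-maximal among lattice-free convex sets, then its base contains
a lattice point in the relative interior: otherwise the pyramid can be extended below its base. -/
theorem exists_intPt_interior_base (hfree : interior (convexHull ℝ (F ∪ {a})) ∩ intPts 3 = ∅)
    (hmax : ∀ K : Set (Fin 3 → ℝ), Convex ℝ K → interior K ∩ intPts 3 = ∅ →
      convexHull ℝ (F ∪ {a}) ⊆ K → convexHull ℝ (F ∪ {a}) = K) :
    (interior (proj2 '' F) ∩ intPts 2).Nonempty := by
  rw [nonempty_iff_ne_empty]
  intro hempty
  obtain ⟨c, hc⟩ := hne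
  have hne : F.Nonempty := ⟨c, hc⟩
  have hc2 : c 2 = 0 := hplane hc
  set P := convexHull ℝ (F ∪ {a}) with hP
  set ε : ℝ := 1 / (2 * H) with hε
  have hε0 : 0 < ε := by positivity
  have hεH : ε * H = 1 / 2 := by rw [hε]; field_simp
  set c' : Fin 3 → ℝ := c - ε • (a - c) with hc'
  have hc'2 : c' 2 = -(1 / 2) := by
    simp only [hc', Pi.sub_apply, Pi.smul_apply, smul_eq_mul, hc2, ha, sub_zero, hεH]
    ring
  have hPne : P.Nonempty := hne.mono (subset_union_left.trans (subset_convexHull ℝ _))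
  have hcvx : Convex ℝ P := convex_convexHull ℝ _
  have hFP : F ⊆ P := subset_union_left.trans (subset_convexHull ℝ _)
  have haP : a ∈ P := subset_convexHull ℝ _ (.inr rfl)
  have hmem : ∀ x ∈ convexHull ℝ (insert c' P), -1 < x 2 ∧ (0 ≤ x 2 → x ∈ P) := by
    intro x hx
    rw [convexHull_insert hPne, hcvx.convexHull_eq, mem_convexJoin] at hx
    obtain ⟨_, rfl, p, hp, hx⟩ := hx
    obtain ⟨y, hy, t, ht0, ht1, rfl⟩ := (mem_pyramid_iff hF hne).1 hp
    rw [segment_eq_image] at hx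
    obtain ⟨s, ⟨hs0, hs1⟩, hsx⟩ := hx
    have hy2 : y 2 = 0 := hplane hy
    have ex : x =
        ((1 - s) * (1 + ε)) • c + (s * (1 - t)) • y + (s * t - (1 - s) * ε) • a := by
      rw [← hsx, hc']
      module
    have e2 : x 2 = (s * t - (1 - s) * ε) * H := by
      rw [ex]
      simp only [Pi.add_apply, Pi.smul_apply, smul_eq_mul, hc2, hy2, ha]
      ring
    constructor
    · rw [e2]
      nlinarith [mul_nonneg (mul_nonneg hs0 ht0) hH.le]
    · intro h0
      rw [e2] at h0
      rw [ex]
      have hpos : 0 ≤ s * t - (1 - s) * ε := nonneg_of_mul_nonneg_left h0 hH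
      have h₁ : 0 ≤ (1 - s) * (1 + ε) := mul_nonneg (by linarith) (by linarith)
      have h₂ : 0 ≤ s * (1 - t) := mul_nonneg hs0 (by linarith)
      have := hcvx.sum_mem (t := Finset.univ)
        (w := ![(1 - s) * (1 + ε), s * (1 - t), s * t - (1 - s) * ε]) (z := ![c, y, a])
        (by intro i _; fin_cases i; exacts [h₁, h₂, hpos])
        (by simp only [Fin.sum_univ_three, Matrix.cons_val_zero, Matrix.cons_val_one,
              Matrix.cons_val]; ring)
        (by intro i _; fin_cases i; exacts [hFP hc, hFP hy, haP])
      simpa [Fin.sum_univ_three] using this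
  have hPK : P ⊆ convexHull ℝ (insert c' P) := (subset_insert _ _).trans (subset_convexHull ℝ _)
  have hKfree : interior (convexHull ℝ (insert c' P)) ∩ intPts 3 = ∅ := by
    rw [eq_empty_iff_forall_notMem]
    rintro x ⟨hx, hint⟩
    obtain ⟨k, hk⟩ := hint 2
    have hk0 : 0 ≤ k := by
      have := (hmem x (interior_subset hx)).1
      rw [hk] at this
      have : (-1 : ℤ) < k := by exact_mod_cast this
      omega
    rw [mem_interior_iff_mem_nhds] at hx
    rcases hk0.eq_or_lt with rfl | hk0
    · have hj : ContinuousAt (fun y : Fin 2 → ℝ => ![y 0, y 1, 0]) (proj2 x) := by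
        refine continuousAt_pi.2 fun i => ?_
        fin_cases i
        exacts [continuousAt_apply 0 _, continuousAt_apply 1 _, continuousAt_const]
      have hjx : ![proj2 x 0, proj2 x 1, 0] = x := by
        ext i
        fin_cases i
        exacts [rfl, rfl, by simp [hk]]
      have hx' : proj2 x ∈ interior (proj2 '' F) := by
        rw [mem_interior_iff_mem_nhds]
        have hj' := hj.tendsto
        simp only [hjx] at hj'
        filter_upwards [hj'.eventually hx] with y hy
        refine ⟨![y 0, y 1, 0], mem_base_of_mem_pyramid hF hne hplane ha hH
          ((hmem _ hy).2 le_rfl) rfl, ?_⟩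
        ext i
        fin_cases i <;> rfl
      refine (eq_empty_iff_forall_notMem.1 hempty) (proj2 x) ⟨hx', fun i => ?_⟩
      fin_cases i
      exacts [hint 0, hint 1]
    · have hx2 : 0 < x 2 := by rw [hk]; exact_mod_cast hk0
      have h2 : ContinuousAt (fun y : Fin 3 → ℝ => y 2) x := continuousAt_apply 2 x
      refine (eq_empty_iff_forall_notMem.1 hfree) x ⟨mem_interior_iff_mem_nhds.2 ?_, hint⟩
      filter_upwards [hx, h2.eventually (lt_mem_nhds hx2)] with y hy hy2
      exact (hmem y hy).2 hy2.le
  have heq := hmax _ (convex_convexHull ℝ _) hKfree hPK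
  have hc'P : c' ∈ P := by
    rw [heq]
    exact subset_convexHull ℝ _ (mem_insert _ _)
  have := (height_mem_of_mem_pyramid hF hne hplane ha hH hc'P).1
  linarith

theorem extremePoints_base_subset :
    extremePoints ℝ F ⊆ extremePoints ℝ (convexHull ℝ (F ∪ {a})) := by
  intro y hy
  have hFP : F ⊆ convexHull ℝ (F ∪ {a}) := subset_union_left.trans (subset_convexHull ℝ _)
  rw [mem_extremePoints] at hy ⊢
  refine ⟨hFP hy.1, fun x₁ h₁ x₂ h₂ hx => ?_⟩
  have k₁ := (height_mem_of_mem_pyramid hF hne hplane ha hH h₁).1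
  have k₂ := (height_mem_of_mem_pyramid hF hne hplane ha hH h₂).1
  have hy2 : y 2 = 0 := hplane hy.1
  obtain ⟨s, t, hs, ht, -, rfl⟩ := id hx
  simp only [Pi.add_apply, Pi.smul_apply, smul_eq_mul] at hy2
  exact hy.2 x₁ (mem_base_of_mem_pyramid hF hne hplane ha hH h₁ (by nlinarith)) x₂
    (mem_base_of_mem_pyramid hF hne hplane ha hH h₂ (by nlinarith)) hx

theorem apex_mem_extremePoints : a ∈ extremePoints ℝ (convexHull ℝ (F ∪ {a})) := by
  rw [mem_extremePoints]
  refine ⟨subset_convexHull ℝ _ (.inr rfl), fun x₁ h₁ x₂ h₂ hx => ?_⟩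
  have k₁ := (height_mem_of_mem_pyramid hF hne hplane ha hH h₁).2
  have k₂ := (height_mem_of_mem_pyramid hF hne hplane ha hH h₂).2
  obtain ⟨s, t, hs, ht, hst, e⟩ := hx
  have e2 := congrFun e 2
  simp only [Pi.add_apply, Pi.smul_apply, smul_eq_mul, ha] at e2
  have hs' : H = s * H + t * H := by rw [← add_mul, hst, one_mul]
  exact ⟨eq_apex_of_mem_pyramid hF hne hplane ha hH h₁ (by nlinarith),
    eq_apex_of_mem_pyramid hF hne hplane ha hH h₂ (by nlinarith)⟩

end Pyramid


/-- The integer point of the coordinate plane `x 2 = 0` over an integer point of the plane. -/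
def basePt (v : ℤ × ℤ) : Fin 3 → ℝ := ![(v.1 : ℝ), (v.2 : ℝ), 0]

theorem basePt_injective : Function.Injective basePt := by
  intro v w hvw
  have h0 := congrFun hvw 0
  have h1 := congrFun hvw 1
  simp only [basePt, Matrix.cons_val_zero, Matrix.cons_val_one, Int.cast_inj] at h0 h1
  exact Prod.ext h0 h1

theorem proj2_image_convexHull (s : Set (Fin 3 → ℝ)) :
    proj2 '' convexHull ℝ s = convexHull ℝ (proj2 '' s) := by
  let f : (Fin 3 → ℝ) →ₗ[ℝ] (Fin 2 → ℝ) :=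
    { toFun := proj2
      map_add' := fun x y => by ext i; fin_cases i <;> rfl
      map_smul' := fun c x => by ext i; fin_cases i <;> rfl }
  exact f.image_convexHull s

/-- Integer coordinates for the vertices of the base. -/
theorem exists_base_vertices {F : Set (Fin 3 → ℝ)} (hcomp : IsCompact F) (hF : Convex ℝ F)
    (hplane : F ⊆ {x | x 2 = 0}) (hfin : (extremePoints ℝ F).Finite)
    (hint : extremePoints ℝ F ⊆ intPts 3) :
    ∃ V : Set (ℤ × ℤ), V.Finite ∧ V.ncard = (extremePoints ℝ F).ncard ∧
      proj2 '' F = polygon V ∧ ((interior (polygon V)).Nonempty → V ⊆ boundaryPts V) := by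
  set V := basePt ⁻¹' extremePoints ℝ F with hV
  have hVfin : V.Finite := hfin.preimage basePt_injective.injOn
  have himage : basePt '' V = extremePoints ℝ F := by
    refine image_preimage_eq_of_subset fun x hx => ?_
    obtain ⟨m, hm⟩ := hint hx 0
    obtain ⟨n, hn⟩ := hint hx 1
    have hx2 : x 2 = 0 := hplane hx.1
    refine ⟨(m, n), ?_⟩
    ext i
    fin_cases i
    exacts [hm.symm, hn.symm, hx2.symm]
  have hhull : convexHull ℝ (extremePoints ℝ F) = F := by
    rw [← (hfin.isClosed_convexHull ℝ).closure_eq, closure_convexHull_extremePoints hcomp hF]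
  have hS : proj2 '' F = polygon V := by
    rw [← hhull, proj2_image_convexHull, ← himage, image_image]
    rfl
  refine ⟨V, hVfin, ?_, hS, fun hne v hv => ⟨?_, fun hin => ?_⟩⟩
  · rw [← himage, Set.ncard_image_of_injective _ basePt_injective]
  · exact covered_of_mem_hull (toReal_mem_hull hv)
  · have hin' : toVec v ∈ interior (polygon V) := (mem_interior_polygon_iff hVfin hne).2 hin
    rw [mem_interior_iff_mem_nhds] at hin'
    have hc₁ : ContinuousAt (fun t : ℝ => toVec v + t • ![1, 0]) 0 := by fun_prop
    have hc₂ : ContinuousAt (fun t : ℝ => toVec v - t • ![1, 0]) 0 := by fun_prop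
    have hev₁ : ∀ᶠ t in nhds (0 : ℝ), toVec v + t • ![1, 0] ∈ polygon V :=
      hc₁.eventually (by simpa using hin')
    have hev₂ : ∀ᶠ t in nhds (0 : ℝ), toVec v - t • ![1, 0] ∈ polygon V :=
      hc₂.eventually (by simpa using hin')
    obtain ⟨t, ⟨ht₁, ht₂⟩, ht0⟩ := (((hev₁.and hev₂).filter_mono nhdsWithin_le_nhds).and
      (self_mem_nhdsWithin (s := Ioi 0))).exists
    rw [← hS] at ht₁ ht₂
    obtain ⟨y₁, hy₁, e₁⟩ := ht₁
    obtain ⟨y₂, hy₂, e₂⟩ := ht₂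
    have p₁ := congrFun e₁ 0
    have p₂ := congrFun e₂ 0
    have q₁ := congrFun e₁ 1
    have q₂ := congrFun e₂ 1
    have r₁ : y₁ 2 = 0 := hplane hy₁
    have r₂ : y₂ 2 = 0 := hplane hy₂
    simp only [proj2, toVec, Pi.add_apply, Pi.sub_apply, Pi.smul_apply, smul_eq_mul,
      Matrix.cons_val_zero, Matrix.cons_val_one] at p₁ p₂ q₁ q₂
    have heq := (mem_extremePoints.1 hv).2 y₁ hy₁ y₂ hy₂
      ⟨1 / 2, 1 / 2, by norm_num, by norm_num, by norm_num, by
        ext i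
        fin_cases i
        · simp only [Fin.zero_eta, Pi.add_apply, Pi.smul_apply, smul_eq_mul, p₁, p₂, basePt,
            Matrix.cons_val_zero]
          ring
        · simp only [Fin.mk_one, Pi.add_apply, Pi.smul_apply, smul_eq_mul, q₁, q₂, basePt,
            Matrix.cons_val_one, Matrix.cons_val_zero]
          ring
        · simp only [Fin.reduceFinMk, Pi.add_apply, Pi.smul_apply, smul_eq_mul, r₁, r₂, basePt,
            Matrix.cons_val]
          ring⟩
    have := congrFun heq.1 0
    simp only [p₁, basePt, Matrix.cons_val_zero, mul_one, add_eq_left] at this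
    exact ht0.ne' this

/-- Lattice-freeness of a pyramid in terms of its sections at heights `1` and `2`. -/
theorem free_of_pyramid {F : Set (Fin 3 → ℝ)} {a : Fin 3 → ℝ} {h : ℤ} (hF : Convex ℝ F)
    (hne : F.Nonempty) (hplane : F ⊆ {x | x 2 = 0}) (ha : a 2 = h) (hh : 4 ≤ h)
    (hfree : interior (convexHull ℝ (F ∪ {a})) ∩ intPts 3 = ∅) {V : Set (ℤ × ℤ)}
    (hV : V.Finite) (hS : proj2 '' F = polygon V) (hint : (interior (polygon V)).Nonempty)
    {α : ℤ × ℤ} (h₀ : a 0 = α.1) (h₁ : a 1 = α.2) : Free V h α := by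
  intro k hk m n hin
  have hh' : (4 : ℝ) ≤ h := by exact_mod_cast hh
  have hk0 : (0 : ℝ) < k := by rcases hk with rfl | rfl <;> norm_num
  have hk2 : (k : ℝ) ≤ 2 := by rcases hk with rfl | rfl <;> norm_num
  refine (eq_empty_iff_forall_notMem.1 hfree) ![(m : ℝ), (n : ℝ), (k : ℝ)] ⟨?_, fun i => ?_⟩
  · refine mem_interior_pyramid_of_section hF hne hplane ha (by linarith) hk0
      (show (k : ℝ) < h by linarith) ?_
    rw [hS, mem_interior_polygon_iff hV hint, h₀, h₁]
    exact hin
  · fin_cases i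
    exacts [⟨m, rfl⟩, ⟨n, rfl⟩, ⟨k, rfl⟩]

end LatticePolygon


/-- Lemma on the base of a maximal lattice-free simplex or quadrangular pyramid of height
`h ≥ 4`: the base `F` (identified with a polygon in `ℝ²`) has lattice width `2` and
satisfies `2·i(F) + b(F) ≤ ⌊(6h-4)/(h-2)⌋ ≤ 10`; moreover `(i(F), b(F))` lies in `Z_S`
for a simplex and in `Z_Q` for a quadrangular pyramid. -/
theorem M3_pyramid_base_bounds (P F : Set (Fin 3 → ℝ)) (a : Fin 3 → ℝ) (h : ℤ)
    (hP : MemM3 P)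
    (hFpoly : ∃ V : Finset (Fin 3 → ℝ), F = convexHull ℝ (V : Set (Fin 3 → ℝ)))
    (hFbase : (Set.extremePoints ℝ F).ncard = 3 ∨ (Set.extremePoints ℝ F).ncard = 4)
    (hFplane : F ⊆ {x : Fin 3 → ℝ | x 2 = 0})
    (ha : a 2 = (h : ℝ)) (hh : 4 ≤ h)
    (hPyr : P = convexHull ℝ (F ∪ {a})) :
    (∀ u : Fin 2 → ℤ, u ≠ 0 → 2 ≤ widthAlong (proj2 '' F) u) ∧
    (∃ u : Fin 2 → ℤ, u ≠ 0 ∧ widthAlong (proj2 '' F) u = 2) ∧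
    ((2 * (intrinsicInterior ℝ (proj2 '' F) ∩ intPts 2).ncard
        + (intrinsicFrontier ℝ (proj2 '' F) ∩ intPts 2).ncard : ℤ) ≤ (6 * h - 4) / (h - 2)) ∧
    ((6 * h - 4) / (h - 2) ≤ 10) ∧
    ((Set.extremePoints ℝ F).ncard = 3 →
      ((intrinsicInterior ℝ (proj2 '' F) ∩ intPts 2).ncard = 1 ∧
        3 ≤ (intrinsicFrontier ℝ (proj2 '' F) ∩ intPts 2).ncard ∧
        (intrinsicFrontier ℝ (proj2 '' F) ∩ intPts 2).ncard ≤ 8) ∨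
      ((intrinsicInterior ℝ (proj2 '' F) ∩ intPts 2).ncard = 2 ∧
        3 ≤ (intrinsicFrontier ℝ (proj2 '' F) ∩ intPts 2).ncard ∧
        (intrinsicFrontier ℝ (proj2 '' F) ∩ intPts 2).ncard ≤ 6)) ∧
    ((Set.extremePoints ℝ F).ncard = 4 →
      ((intrinsicInterior ℝ (proj2 '' F) ∩ intPts 2).ncard = 1 ∧
        4 ≤ (intrinsicFrontier ℝ (proj2 '' F) ∩ intPts 2).ncard ∧
        (intrinsicFrontier ℝ (proj2 '' F) ∩ intPts 2).ncard ≤ 8) ∨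
      ((intrinsicInterior ℝ (proj2 '' F) ∩ intPts 2).ncard = 2 ∧
        4 ≤ (intrinsicFrontier ℝ (proj2 '' F) ∩ intPts 2).ncard ∧
        (intrinsicFrontier ℝ (proj2 '' F) ∩ intPts 2).ncard ≤ 6)) := by
  obtain ⟨-, -, hPint, -, hPfree, hPmax⟩ := hP
  obtain ⟨W, hW⟩ := hFpoly
  have hcard : (Set.extremePoints ℝ F).ncard ≠ 0 := by omega
  have hext := Set.finite_of_ncard_ne_zero hcard
  have hF : Convex ℝ F := hW ▸ convex_convexHull ℝ _
  have hFcomp : IsCompact F := hW ▸ W.finite_toSet.isCompact_convexHull ℝ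
  have hne : F.Nonempty := (Set.nonempty_of_ncard_ne_zero hcard).mono extremePoints_subset
  have hH : (0 : ℝ) < h := by exact_mod_cast (by omega : 0 < h)
  have hPext : Set.extremePoints ℝ P ⊆ P ∩ intPts 3 := by
    have := extremePoints_convexHull_subset (𝕜 := ℝ) (A := P ∩ intPts 3)
    rwa [← hPint] at this
  rw [hPyr] at hPext hPfree hPmax
  have haint := (hPext (LatticePolygon.apex_mem_extremePoints hF hne hFplane ha hH)).2
  obtain ⟨α₁, hα₁⟩ := haint 0
  obtain ⟨α₂, hα₂⟩ := haint 1
  obtain ⟨x, hx, hxint⟩ :=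
    LatticePolygon.exists_intPt_interior_base hF hne hFplane ha hH hPfree hPmax
  obtain ⟨V, hV, hVcard, hS, hVb⟩ := LatticePolygon.exists_base_vertices hFcomp hF hFplane hext
    fun y hy =>
      (hPext (LatticePolygon.extremePoints_base_subset hF hne hFplane ha hH hy)).2
  rw [hS] at hx ⊢
  have hint : (interior (LatticePolygon.polygon V)).Nonempty := ⟨x, hx⟩
  have hinner := LatticePolygon.intrinsicInterior_polygon_inter hV hint
  have hxi : x ∈ LatticePolygon.toVec '' LatticePolygon.innerPts V := by
    rw [← hinner, LatticePolygon.intrinsicInterior_eq_interior (LatticePolygon.convex_polygon V)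
      hint]
    exact ⟨hx, hxint⟩
  obtain ⟨z, hz, -⟩ := hxi
  rw [hinner, LatticePolygon.intrinsicFrontier_polygon_inter hV hint,
    Set.ncard_image_of_injective _ LatticePolygon.toVec_injective,
    Set.ncard_image_of_injective _ LatticePolygon.toVec_injective]
  have hfree : LatticePolygon.Free V h (α₁, α₂) :=
    LatticePolygon.free_of_pyramid hF hne hFplane ha hh hPfree hV hS hint hα₁ hα₂
  obtain ⟨hcount, hle2⟩ := hfree.count_bounds hV hh ⟨z, hz⟩
  have hcov := LatticePolygon.finite_covered hV
  have hi1 : 1 ≤ (LatticePolygon.innerPts V).ncard :=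
    (Set.ncard_pos (hcov.subset fun _ => LatticePolygon.covered_of_inside)).2 ⟨z, hz⟩
  have hbV : V.ncard ≤ (LatticePolygon.boundaryPts V).ncard :=
    Set.ncard_le_ncard (hVb hint) (hcov.subset fun _ hw => hw.1)
  have hwidth : ∀ u : Fin 2 → ℤ, u ≠ 0 → 2 ≤ widthAlong (LatticePolygon.polygon V) u :=
    fun u => LatticePolygon.two_le_widthAlong_polygon hV
      (LatticePolygon.widthGe_two_of_inside hz)
  obtain ⟨u, hu, hu2⟩ := LatticePolygon.exists_widthAlong_polygon_le_two hV
    (Set.nonempty_of_ncard_ne_zero (hVcard.trans_ne hcard)) (hfree.not_widthGe_three hV hh)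
  have hfloor := (Int.le_ediv_iff_mul_le (by omega : 0 < h - 2)).2 hcount
  have hten : (6 * h - 4) / (h - 2) ≤ 10 :=
    Int.lt_add_one_iff.1 ((Int.ediv_lt_iff_lt_mul (by omega)).2 (by omega))
  exact ⟨hwidth, ⟨u, hu, le_antisymm hu2 (hwidth u hu)⟩, hfloor, hten,
    fun _ => by omega, fun _ => by omega⟩
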